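/- arXiv:1901.09996 — 10 statements merged into one kernel-verified Lean document; each statement's English description precedes it below -/
import Mathlib

section
/- Let α ∈ (1,2], η ∈ (0,1], and λ ∈ ℝ with λη² ≠ 2. Let h : [0,1] → ℝ be continuous, and define x(t) = ∫₀¹ K(t,s) h(s) ds for t ∈ [0,1] (the integral converges since α > 1). Then x is continuous on [0,1], twice differentiable on (0,1), satisfies t^(2-α)·x''(t) + h(t) = 0 for all t ∈ (0,1), x(0) = 0, and x(1) = λ·∫₀^η x(t) dt. -/
open Set MeasureTheory

/-- The Green's function `G(t,s)` for the conformable fractional BVP. -/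
noncomputable def Gf (α t s : ℝ) : ℝ :=
  if s ≤ t then (1 - t) * s ^ (α - 1) else t * (1 - s) * s ^ (α - 2)

/-- The auxiliary kernel `H(t,s)` for the conformable fractional BVP. -/
noncomputable def Hf (α t s : ℝ) : ℝ :=
  if s ≤ t then (2 * t - t ^ 2 - s) * s ^ (α - 1) else t ^ 2 * (1 - s) * s ^ (α - 2)

/-- The full kernel `K(t,s) = G(t,s) + (λ t/(2 - λ η²)) H(η,s)`. -/
noncomputable def Kf (α η lam t s : ℝ) : ℝ :=
  Gf α t s + lam * t / (2 - lam * η ^ 2) * Hf α η s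

/-- The fundamental theorem of calculus for an integrable function continuous on `(0,1)`. -/
theorem hasDerivAt_primitive {f : ℝ → ℝ} (hf : IntervalIntegrable f volume 0 1)
    (hc : ContinuousOn f (Ioo 0 1)) {t : ℝ} (ht : t ∈ Ioo (0 : ℝ) 1) :
    HasDerivAt (fun u => ∫ s in (0 : ℝ)..u, f s) (f t) t := by
  refine intervalIntegral.integral_hasDerivAt_right (hf.mono_set ?_)
    (hc.stronglyMeasurableAtFilter isOpen_Ioo t ht) (hc.continuousAt (isOpen_Ioo.mem_nhds ht))
  rw [uIcc_of_le ht.1.le, uIcc_of_le zero_le_one]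
  exact Icc_subset_Icc_right ht.2.le

theorem continuousOn_primitive_Icc {f : ℝ → ℝ} (hf : IntervalIntegrable f volume 0 1) :
    ContinuousOn (fun u => ∫ s in (0 : ℝ)..u, f s) (Icc 0 1) := by
  have := intervalIntegral.continuousOn_primitive_interval' hf left_mem_uIcc
  rwa [uIcc_of_le zero_le_one] at this

/-- Integral of a kernel that is piecewise affine in `s` up to the weight `s ^ (α - 2)`. -/
theorem integral_piecewise_kernel {α a b c t : ℝ} {h : ℝ → ℝ} (ht : t ∈ Icc (0 : ℝ) 1)
    {p : ℝ → ℝ} (hp : ∀ s, p s = s ^ (α - 2) * h s)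
    (hpi : IntervalIntegrable p volume 0 1)
    (hqi : IntervalIntegrable (fun s => s * p s) volume 0 1)
    (hri : IntervalIntegrable (fun s => s * (s * p s)) volume 0 1)
    {k : ℝ → ℝ}
    (hk : ∀ s, k s = if s ≤ t then (a + b * s) * s ^ (α - 1) else c * (1 - s) * s ^ (α - 2)) :
    IntervalIntegrable (fun s => k s * h s) volume 0 1 ∧
    ∫ s in (0 : ℝ)..1, k s * h s =
      a * (∫ s in (0 : ℝ)..t, s * p s) + b * (∫ s in (0 : ℝ)..t, s * (s * p s)) +
      c * (((∫ s in (0 : ℝ)..1, p s) - ∫ s in (0 : ℝ)..t, p s) -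
        ((∫ s in (0 : ℝ)..1, s * p s) - ∫ s in (0 : ℝ)..t, s * p s)) := by
  have s1 : uIcc 0 t ⊆ uIcc (0 : ℝ) 1 := by
    rw [uIcc_of_le ht.1, uIcc_of_le zero_le_one]; exact Icc_subset_Icc_right ht.2
  have s2 : uIcc t 1 ⊆ uIcc (0 : ℝ) 1 := by
    rw [uIcc_of_le ht.2, uIcc_of_le zero_le_one]; exact Icc_subset_Icc_left ht.1
  have e1 : EqOn (fun s => a * (s * p s) + b * (s * (s * p s))) (fun s => k s * h s)
      (uIoc 0 t) := by
    intro s hs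
    rw [uIoc_of_le ht.1] at hs
    have : s ^ (α - 1) = s * s ^ (α - 2) := by
      rw [show α - 1 = 1 + (α - 2) by ring, Real.rpow_add hs.1, Real.rpow_one]
    simp only [hk, if_pos hs.2, this, hp]
    ring
  have e2 : EqOn (fun s => c * (p s - s * p s)) (fun s => k s * h s) (uIoc t 1) := by
    intro s hs
    rw [uIoc_of_le ht.2] at hs
    simp only [hk, if_neg hs.1.not_ge, hp]
    ring
  have i1 := ((hqi.mono_set s1).const_mul a).add ((hri.mono_set s1).const_mul b)
  have i2 := ((hpi.mono_set s2).sub (hqi.mono_set s2)).const_mul c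
  have j1 : IntervalIntegrable (fun s => k s * h s) volume 0 t := i1.congr e1
  have j2 : IntervalIntegrable (fun s => k s * h s) volume t 1 := i2.congr e2
  refine ⟨j1.trans j2, ?_⟩
  rw [← intervalIntegral.integral_add_adjacent_intervals j1 j2,
    ← intervalIntegral.integral_congr_ae (Filter.Eventually.of_forall e1),
    ← intervalIntegral.integral_congr_ae (Filter.Eventually.of_forall e2),
    intervalIntegral.integral_add ((hqi.mono_set s1).const_mul a) ((hri.mono_set s1).const_mul b),
    intervalIntegral.integral_const_mul, intervalIntegral.integral_const_mul,
    intervalIntegral.integral_const_mul,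
    intervalIntegral.integral_sub (hpi.mono_set s2) (hqi.mono_set s2),
    ← intervalIntegral.integral_interval_sub_left hpi (hpi.mono_set s1),
    ← intervalIntegral.integral_interval_sub_left hqi (hqi.mono_set s1)]

theorem stmt0 (α η lam : ℝ) (hα : α ∈ Set.Ioc (1 : ℝ) 2) (hη : η ∈ Set.Ioc (0 : ℝ) 1)
    (hlam : lam * η ^ 2 ≠ 2) (h : ℝ → ℝ) (hh : ContinuousOn h (Set.Icc 0 1))
    (x : ℝ → ℝ) (hx : ∀ t, x t = ∫ s in (0 : ℝ)..1, Kf α η lam t s * h s) :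
    ContinuousOn x (Set.Icc 0 1) ∧
    (∀ t ∈ Set.Ioo (0 : ℝ) 1, DifferentiableAt ℝ x t ∧ DifferentiableAt ℝ (deriv x) t ∧
      t ^ (2 - α) * deriv (deriv x) t + h t = 0) ∧
    x 0 = 0 ∧ x 1 = lam * ∫ t in (0 : ℝ)..η, x t := by
  obtain ⟨p, hp⟩ : ∃ p : ℝ → ℝ, ∀ s, p s = s ^ (α - 2) * h s := ⟨_, fun _ => rfl⟩
  have hpi : IntervalIntegrable p volume 0 1 := by
    rw [funext hp]
    refine (intervalIntegral.intervalIntegrable_rpow' (by linarith [hα.1])).mul_continuousOn ?_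
    rwa [uIcc_of_le zero_le_one]
  have hqi : IntervalIntegrable (fun s => s * p s) volume 0 1 :=
    hpi.continuousOn_mul continuousOn_id
  have hri : IntervalIntegrable (fun s => s * (s * p s)) volume 0 1 :=
    hqi.continuousOn_mul continuousOn_id
  have hpc : ContinuousOn p (Ioo 0 1) := by
    rw [funext hp]
    exact (continuousOn_id.rpow_const fun s hs => Or.inl hs.1.ne').mul
      (hh.mono Ioo_subset_Icc_self)
  have hqc : ContinuousOn (fun s => s * p s) (Ioo 0 1) := continuousOn_id.mul hpc
  have hrc : ContinuousOn (fun s => s * (s * p s)) (Ioo 0 1) := continuousOn_id.mul hqc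
  have hP' := fun t (ht : t ∈ Ioo (0 : ℝ) 1) => hasDerivAt_primitive hpi hpc ht
  have hQ' := fun t (ht : t ∈ Ioo (0 : ℝ) 1) => hasDerivAt_primitive hqi hqc ht
  have hR' := fun t (ht : t ∈ Ioo (0 : ℝ) 1) => hasDerivAt_primitive hri hrc ht
  have hPc := continuousOn_primitive_Icc hpi
  have hQc := continuousOn_primitive_Icc hqi
  have hRc := continuousOn_primitive_Icc hri
  have hG := fun t (ht : t ∈ Icc (0 : ℝ) 1) =>
    integral_piecewise_kernel (a := 1 - t) (b := 0) (c := t) (k := Gf α t) ht hp hpi hqi hri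
      (fun s => by simp [Gf])
  have hH := integral_piecewise_kernel (a := 2 * η - η ^ 2) (b := -1) (c := η ^ 2)
    (k := Hf α η) ⟨hη.1.le, hη.2⟩ hp hpi hqi hri
    (fun s => by simp only [Hf]; congr 2; ring)
  have hQ0 : ∫ s in (0 : ℝ)..0, s * p s = 0 := intervalIntegral.integral_same
  have hR0 : ∫ s in (0 : ℝ)..0, s * (s * p s) = 0 := intervalIntegral.integral_same
  generalize hB : ∫ s in (0 : ℝ)..1, Hf α η s * h s = B at hH
  have hxK : ∀ t ∈ Icc (0 : ℝ) 1,
      x t = (∫ s in (0 : ℝ)..1, Gf α t s * h s) + lam * t / (2 - lam * η ^ 2) * B := by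
    intro t ht
    rw [hx, ← hB, ← intervalIntegral.integral_const_mul,
      ← intervalIntegral.integral_add (hG t ht).1 (hH.1.const_mul _)]
    congr 1
    ext s
    simp only [Kf]
    ring
  generalize hP : (fun u => ∫ s in (0 : ℝ)..u, p s) = P at hP' hPc
  generalize hQ : (fun u => ∫ s in (0 : ℝ)..u, s * p s) = Q at hQ' hQc
  generalize hR : (fun u => ∫ s in (0 : ℝ)..u, s * (s * p s)) = R at hR' hRc
  replace hP := congrFun hP
  replace hQ := congrFun hQ
  replace hR := congrFun hR
  simp only [hP, hQ, hR] at hG hH hQ0 hR0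
  obtain ⟨c, hc⟩ : ∃ c, c = P 1 - Q 1 + lam / (2 - lam * η ^ 2) * B := ⟨_, rfl⟩
  have hxf : ∀ t ∈ Icc (0 : ℝ) 1, x t = Q t - t * P t + t * c := by
    intro t ht
    rw [hxK t ht, (hG t ht).2, hc]
    ring
  have hx' : ∀ t ∈ Ioo (0 : ℝ) 1, HasDerivAt x (c - P t) t := by
    intro t ht
    have h1 : HasDerivAt (fun t => Q t - t * P t + t * c) (c - P t) t := by
      refine (((hQ' t ht).sub ((hasDerivAt_id t).mul (hP' t ht))).add
        ((hasDerivAt_id t).mul_const c)).congr_deriv ?_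
      simp only [id]
      ring
    refine h1.congr_of_eventuallyEq ?_
    filter_upwards [isOpen_Ioo.mem_nhds ht] with u hu using hxf u (Ioo_subset_Icc_self hu)
  have hx'' : ∀ t ∈ Ioo (0 : ℝ) 1, HasDerivAt (deriv x) (-p t) t := by
    intro t ht
    refine ((hP' t ht).const_sub c).congr_of_eventuallyEq ?_
    filter_upwards [isOpen_Ioo.mem_nhds ht] with u hu using (hx' u hu).deriv
  have hxc : ContinuousOn x (Icc 0 1) :=
    ((hQc.sub (continuousOn_id.mul hPc)).add (continuousOn_id.mul continuousOn_const)).congr hxf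
  refine ⟨hxc, fun t ht => ⟨(hx' t ht).differentiableAt, (hx'' t ht).differentiableAt, ?_⟩, ?_, ?_⟩
  · have h1 : t ^ (2 - α) * t ^ (α - 2) = 1 := by
      rw [← Real.rpow_add ht.1]
      simp
    rw [(hx'' t ht).deriv, hp]
    linear_combination -h t * h1
  · rw [hxf 0 (by simp), hQ0]
    ring
  · have hsub : Icc 0 η ⊆ Icc (0 : ℝ) 1 := Icc_subset_Icc_right hη.2
    have hF : ∫ t in (0 : ℝ)..η, x t =
        (η * Q η - R η / 2 - η ^ 2 * P η / 2 + η ^ 2 * c / 2) -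
        (0 * Q 0 - R 0 / 2 - 0 ^ 2 * P 0 / 2 + 0 ^ 2 * c / 2) := by
      refine intervalIntegral.integral_eq_sub_of_hasDerivAt_of_le
        (f := fun t => t * Q t - R t / 2 - t ^ 2 * P t / 2 + t ^ 2 * c / 2) hη.1.le ?_ ?_ ?_
      · have := hQc.mono hsub
        have := hRc.mono hsub
        have := hPc.mono hsub
        fun_prop
      · intro t ht
        have ht' : t ∈ Ioo (0 : ℝ) 1 := ⟨ht.1, ht.2.trans_le hη.2⟩
        rw [hxf t (Ioo_subset_Icc_self ht')]
        refine (((((hasDerivAt_id t).mul (hQ' t ht')).sub ((hR' t ht').div_const 2)).sub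
          (((hasDerivAt_pow 2 t).mul (hP' t ht')).div_const 2)).add
          (((hasDerivAt_pow 2 t).mul_const c).div_const 2)).congr_deriv ?_
        simp only [id]
        push_cast
        ring
      · exact (hxc.mono (by rwa [uIcc_of_le hη.1.le])).intervalIntegrable
    have hd : 2 - lam * η ^ 2 ≠ 0 := fun h0 => hlam (by linarith)
    rw [hF, hxf 1 (by simp), hR0, hc]
    have hB' := hH.2
    have hdiv : lam / (2 - lam * η ^ 2) * B * (2 - lam * η ^ 2) = lam * B := by
      field_simp
    linear_combination (1 / 2) * hdiv + (lam / 2) * hB'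
end

section
/- Let α ∈ (1,2], η ∈ (0,1], and λ ∈ ℝ with λη² ≠ 2. Let h : [0,1] → ℝ be continuous. If x : [0,1] → ℝ is continuous on [0,1], twice differentiable on (0,1), and satisfies t^(2-α)·x''(t) + h(t) = 0 for all t ∈ (0,1), x(0) = 0, and x(1) = λ·∫₀^η x(t) dt, then x(t) = ∫₀¹ K(t,s) h(s) ds for every t ∈ [0,1]. -/
open Set MeasureTheory

/-- Integration by parts against a quadratic polynomial, where `x' = v` and `v' = -f`. -/
theorem integral_quadratic_mul {x v f : ℝ → ℝ} (hxc : ContinuousOn x (Icc 0 1))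
    (hvc : ContinuousOn v (Icc 0 1)) (hx : ∀ t ∈ Ioo (0 : ℝ) 1, HasDerivAt x (v t) t)
    (hv : ∀ t ∈ Ioo (0 : ℝ) 1, HasDerivAt v (-f t) t)
    (hf : IntervalIntegrable f volume 0 1) (c₀ c₁ c₂ : ℝ) {a b : ℝ} (ha : 0 ≤ a) (hab : a ≤ b)
    (hb : b ≤ 1) :
    IntervalIntegrable (fun s => (c₀ + c₁ * s + c₂ * s ^ 2) * f s) volume a b ∧
    ∫ s in a..b, (c₀ + c₁ * s + c₂ * s ^ 2) * f s =
      ((c₀ + c₁ * a + c₂ * a ^ 2) * v a - (c₁ + 2 * c₂ * a) * x a) -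
      ((c₀ + c₁ * b + c₂ * b ^ 2) * v b - (c₁ + 2 * c₂ * b) * x b) -
      2 * c₂ * ∫ s in a..b, x s := by
  have hsub : Icc a b ⊆ Icc 0 1 := Icc_subset_Icc ha hb
  have hfab : IntervalIntegrable f volume a b := hf.mono_set (by
    rwa [uIcc_of_le hab, uIcc_of_le zero_le_one])
  have hpf : IntervalIntegrable (fun s => (c₀ + c₁ * s + c₂ * s ^ 2) * f s) volume a b :=
    hfab.continuousOn_mul (by fun_prop)
  have hxi : IntervalIntegrable x volume a b :=
    (hxc.mono hsub).intervalIntegrable_of_Icc hab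
  have hxi' : IntervalIntegrable (fun s => 2 * c₂ * x s) volume a b := hxi.const_mul _
  have hnpf : IntervalIntegrable (fun s => -((c₀ + c₁ * s + c₂ * s ^ 2) * f s)) volume a b :=
    hpf.neg
  refine ⟨hpf, ?_⟩
  have key := intervalIntegral.integral_eq_sub_of_hasDerivAt_of_le hab
    (f := fun s => (c₀ + c₁ * s + c₂ * s ^ 2) * v s - (c₁ + 2 * c₂ * s) * x s)
    (f' := fun s => -((c₀ + c₁ * s + c₂ * s ^ 2) * f s) - 2 * c₂ * x s)
    (by
      have h₁ := hvc.mono hsub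
      have h₂ := hxc.mono hsub
      fun_prop)
    (fun s hs => by
      have hs' : s ∈ Ioo (0 : ℝ) 1 := ⟨ha.trans_lt hs.1, hs.2.trans_le hb⟩
      have hid := hasDerivAt_id' s
      have hp := ((hid.const_mul c₁).const_add c₀).fun_add ((hid.fun_pow 2).const_mul c₂)
      have hq := (hid.const_mul (2 * c₂)).const_add c₁
      refine ((hp.fun_mul (hv s hs')).fun_sub (hq.fun_mul (hx s hs'))).congr_deriv ?_
      push_cast
      ring)
    (hnpf.sub hxi')
  rw [intervalIntegral.integral_sub hnpf hxi', intervalIntegral.integral_neg,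
    intervalIntegral.integral_const_mul] at key
  linarith

/-- The integral of a kernel that is a quadratic vanishing at `0` to the left of `t` and a linear
function vanishing at `1` to the right of `t`. -/
theorem integral_piecewise_kernel_s1 {x v f k : ℝ → ℝ} (hxc : ContinuousOn x (Icc 0 1))
    (hvc : ContinuousOn v (Icc 0 1)) (hx : ∀ t ∈ Ioo (0 : ℝ) 1, HasDerivAt x (v t) t)
    (hv : ∀ t ∈ Ioo (0 : ℝ) 1, HasDerivAt v (-f t) t)
    (hf : IntervalIntegrable f volume 0 1) (hx0 : x 0 = 0) (c₁ c₂ d : ℝ) {t : ℝ}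
    (ht : t ∈ Icc (0 : ℝ) 1)
    (hleft : ∀ s ∈ Ioc 0 t, k s = (c₁ * s + c₂ * s ^ 2) * f s)
    (hright : ∀ s ∈ Ioc t 1, k s = d * (1 - s) * f s) :
    IntervalIntegrable k volume 0 1 ∧
    ∫ s in (0 : ℝ)..1, k s =
      (d * (1 - t) - (c₁ * t + c₂ * t ^ 2)) * v t + (c₁ + 2 * c₂ * t + d) * x t - d * x 1 -
      2 * c₂ * ∫ s in (0 : ℝ)..t, x s := by
  obtain ⟨i₁, e₁⟩ := integral_quadratic_mul hxc hvc hx hv hf 0 c₁ c₂ le_rfl ht.1 ht.2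
  obtain ⟨i₂, e₂⟩ := integral_quadratic_mul hxc hvc hx hv hf d (-d) 0 ht.1 ht.2 le_rfl
  have h₁ : EqOn (fun s => (0 + c₁ * s + c₂ * s ^ 2) * f s) k (uIoc 0 t) := by
    intro s hs
    rw [uIoc_of_le ht.1] at hs
    simp only [hleft s hs, zero_add]
  have h₂ : EqOn (fun s => (d + -d * s + 0 * s ^ 2) * f s) k (uIoc t 1) := by
    intro s hs
    rw [uIoc_of_le ht.2] at hs
    simp only [hright s hs]
    ring
  have k₁ := i₁.congr h₁
  have k₂ := i₂.congr h₂
  refine ⟨k₁.trans k₂, ?_⟩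
  rw [← intervalIntegral.integral_add_adjacent_intervals k₁ k₂,
    ← intervalIntegral.integral_congr_ae (ae_of_all _ h₁),
    ← intervalIntegral.integral_congr_ae (ae_of_all _ h₂), e₁, e₂, hx0]
  ring

/-- If `x'' = -f` on `(0,1)` with `f` integrable, then `x'` extends continuously to `[0,1]`. -/
theorem exists_continuousOn_extension_deriv {x f : ℝ → ℝ} (hf : IntervalIntegrable f volume 0 1)
    (hfc : ContinuousOn f (Ioo 0 1)) (hx : ∀ t ∈ Ioo (0 : ℝ) 1, DifferentiableAt ℝ x t)
    (hx' : ∀ t ∈ Ioo (0 : ℝ) 1, HasDerivAt (deriv x) (-f t) t) :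
    ∃ v : ℝ → ℝ, ContinuousOn v (Icc 0 1) ∧ (∀ t ∈ Ioo (0 : ℝ) 1, HasDerivAt x (v t) t) ∧
      ∀ t ∈ Ioo (0 : ℝ) 1, HasDerivAt v (-f t) t := by
  set F : ℝ → ℝ := fun t => ∫ s in (0 : ℝ)..t, f s
  have hFc : ContinuousOn F (Icc 0 1) := by
    simpa only [uIcc_of_le zero_le_one] using
      intervalIntegral.continuousOn_primitive_interval' hf left_mem_uIcc
  have hF : ∀ t ∈ Ioo (0 : ℝ) 1, HasDerivAt F (f t) t := by
    intro t ht
    refine intervalIntegral.integral_hasDerivAt_right (hf.mono_set ?_)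
      (hfc.stronglyMeasurableAtFilter isOpen_Ioo t ht) (hfc.continuousAt (isOpen_Ioo.mem_nhds ht))
    rw [uIcc_of_le ht.1.le, uIcc_of_le zero_le_one]
    exact Icc_subset_Icc_right ht.2.le
  have hsum : ∀ t ∈ Ioo (0 : ℝ) 1, HasDerivAt (fun s => deriv x s + F s) 0 t := fun t ht =>
    ((hx' t ht).fun_add (hF t ht)).congr_deriv (by ring)
  obtain ⟨C, hC⟩ := isOpen_Ioo.exists_is_const_of_deriv_eq_zero isPreconnected_Ioo
    (fun t ht => (hsum t ht).differentiableAt.differentiableWithinAt)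
    (fun t ht => (hsum t ht).deriv)
  refine ⟨fun t => C - F t, by fun_prop, fun t ht => ?_, fun t ht => (hF t ht).const_sub C⟩
  refine (hx t ht).hasDerivAt.congr_deriv ?_
  linarith [hC t ht]

theorem stmt1 (α η lam : ℝ) (hα : α ∈ Set.Ioc (1 : ℝ) 2) (hη : η ∈ Set.Ioc (0 : ℝ) 1)
    (hlam : lam * η ^ 2 ≠ 2) (h : ℝ → ℝ) (hh : ContinuousOn h (Set.Icc 0 1))
    (x : ℝ → ℝ) (hxc : ContinuousOn x (Set.Icc 0 1))
    (hxde : ∀ t ∈ Set.Ioo (0 : ℝ) 1, DifferentiableAt ℝ x t ∧ DifferentiableAt ℝ (deriv x) t ∧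
      t ^ (2 - α) * deriv (deriv x) t + h t = 0)
    (hx0 : x 0 = 0) (hx1 : x 1 = lam * ∫ t in (0 : ℝ)..η, x t) :
    ∀ t ∈ Set.Icc (0 : ℝ) 1, x t = ∫ s in (0 : ℝ)..1, Kf α η lam t s * h s := by
  obtain ⟨hα1, -⟩ := hα
  set f : ℝ → ℝ := fun s => s ^ (α - 2) * h s with hfdef
  have hf : IntervalIntegrable f volume 0 1 :=
    (intervalIntegral.intervalIntegrable_rpow' (by linarith)).mul_continuousOn
      (by rwa [uIcc_of_le zero_le_one])
  have hfc : ContinuousOn f (Ioo 0 1) :=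
    (continuousOn_id.rpow_const fun s hs => Or.inl hs.1.ne').mul (hh.mono Ioo_subset_Icc_self)
  have hx' : ∀ t ∈ Ioo (0 : ℝ) 1, HasDerivAt (deriv x) (-f t) t := by
    intro t ht
    obtain ⟨-, hd, he⟩ := hxde t ht
    refine hd.hasDerivAt.congr_deriv ?_
    have hmul : t ^ (α - 2) * t ^ (2 - α) = 1 := by
      rw [← Real.rpow_add ht.1]
      simp
    simp only [hfdef]
    linear_combination t ^ (α - 2) * he - deriv (deriv x) t * hmul
  obtain ⟨v, hvc, hxv, hv⟩ :=
    exists_continuousOn_extension_deriv hf hfc (fun t ht => (hxde t ht).1) hx'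
  have hpow : ∀ s : ℝ, 0 < s → s ^ (α - 1) = s * s ^ (α - 2) := by
    intro s hs
    rw [show α - 1 = 1 + (α - 2) by ring, Real.rpow_add hs, Real.rpow_one]
  intro t ht
  obtain ⟨iG, eG⟩ := integral_piecewise_kernel_s1 (k := fun s => Gf α t s * h s)
    hxc hvc hxv hv hf hx0 (1 - t) 0 t ht
    (fun s hs => by
      simp only [Gf, if_pos hs.2, hpow s hs.1, hfdef]
      ring)
    (fun s hs => by
      simp only [Gf, if_neg hs.1.not_ge, hfdef]
      ring)
  obtain ⟨iH, eH⟩ := integral_piecewise_kernel_s1 (k := fun s => Hf α η s * h s)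
    hxc hvc hxv hv hf hx0 (2 * η - η ^ 2) (-1) (η ^ 2) (Ioc_subset_Icc_self hη)
    (fun s hs => by
      simp only [Hf, if_pos hs.2, hpow s hs.1, hfdef]
      ring)
    (fun s hs => by
      simp only [Hf, if_neg hs.1.not_ge, hfdef]
      ring)
  have hsplit : ∀ s, Kf α η lam t s * h s =
      Gf α t s * h s + lam * t / (2 - lam * η ^ 2) * (Hf α η s * h s) := by
    intro s
    simp only [Kf]
    ring
  have hne : 2 - lam * η ^ 2 ≠ 0 := sub_ne_zero.2 hlam.symm
  simp only [hsplit]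
  rw [intervalIntegral.integral_add iG (iH.const_mul _), intervalIntegral.integral_const_mul,
    eG, eH]
  field_simp
  linear_combination 2 * t * hx1
end

section
/- Let α ∈ (1,2]. For all (t,s) ∈ (0,1] × (0,1], t·(1-t)·(1-s)·s^(α-1) ≤ G(t,s) ≤ (1-s)·s^(α-1). -/
open Set

theorem stmt2 (α : ℝ) (hα : α ∈ Set.Ioc (1 : ℝ) 2) :
    ∀ t ∈ Set.Ioc (0 : ℝ) 1, ∀ s ∈ Set.Ioc (0 : ℝ) 1,
      t * (1 - t) * ((1 - s) * s ^ (α - 1)) ≤ Gf α t s ∧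
        Gf α t s ≤ (1 - s) * s ^ (α - 1) := by
  rintro t ⟨ht0, ht1⟩ s ⟨hs0, hs1⟩
  have ht : 0 ≤ 1 - t := sub_nonneg.2 ht1
  have hs : 0 ≤ 1 - s := sub_nonneg.2 hs1
  unfold Gf
  split_ifs with hst
  · have hq : 0 ≤ s ^ (α - 1) := Real.rpow_nonneg hs0.le _
    constructor
    · have h : t * (1 - s) ≤ 1 := mul_le_one₀ ht1 hs (by linarith)
      calc t * (1 - t) * ((1 - s) * s ^ (α - 1))
          = t * (1 - s) * ((1 - t) * s ^ (α - 1)) := by ring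
        _ ≤ (1 - t) * s ^ (α - 1) := mul_le_of_le_one_left (mul_nonneg ht hq) h
    · gcongr
  · have hp : 0 ≤ s ^ (α - 2) := Real.rpow_nonneg hs0.le _
    have hpow : s ^ (α - 1) = s ^ (α - 2) * s := by
      rw [← Real.rpow_add_one hs0.ne']
      ring_nf
    rw [hpow]
    constructor
    · have h : (1 - t) * s ≤ 1 := mul_le_one₀ (by linarith) hs0.le hs1
      calc t * (1 - t) * ((1 - s) * (s ^ (α - 2) * s))
          = (1 - t) * s * (t * (1 - s) * s ^ (α - 2)) := by ring
        _ ≤ t * (1 - s) * s ^ (α - 2) := mul_le_of_le_one_left (by positivity) h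
    · calc t * (1 - s) * s ^ (α - 2) ≤ s * (1 - s) * s ^ (α - 2) := by
            gcongr
            exact (not_le.1 hst).le
        _ = (1 - s) * (s ^ (α - 2) * s) := by ring
end

section
/- Let α ∈ (1,2] and let θ ∈ (0, 1/2) be fixed. For all (t,s) ∈ [θ, 1-θ] × (0,1], θ²·G(s,s) ≤ G(t,s) ≤ G(s,s), where G(s,s) = (1-s)·s^(α-1). -/
open Set

theorem stmt3 (α θ : ℝ) (hα : α ∈ Set.Ioc (1 : ℝ) 2) (hθ : θ ∈ Set.Ioo (0 : ℝ) (1 / 2)) :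
    ∀ t ∈ Set.Icc θ (1 - θ), ∀ s ∈ Set.Ioc (0 : ℝ) 1,
      θ ^ 2 * ((1 - s) * s ^ (α - 1)) ≤ Gf α t s ∧
        Gf α t s ≤ (1 - s) * s ^ (α - 1) := by
  rintro t ⟨ht₁, ht₂⟩ s ⟨hs₀, hs₁⟩
  obtain ⟨hθ₀, hθ₁⟩ := hθ
  have hθ_sq : θ ^ 2 ≤ θ := by nlinarith
  unfold Gf
  split_ifs with hst
  · have hp : 0 ≤ s ^ (α - 1) := Real.rpow_nonneg hs₀.le _
    rw [← mul_assoc]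
    constructor <;> refine mul_le_mul_of_nonneg_right ?_ hp
    · nlinarith [mul_nonneg (sq_nonneg θ) hs₀.le]
    · linarith
  · have hp : 0 ≤ (1 - s) * s ^ (α - 2) :=
      mul_nonneg (by linarith) (Real.rpow_nonneg hs₀.le _)
    have hpow : s ^ (α - 1) = s * s ^ (α - 2) := by
      rw [show α - 1 = 1 + (α - 2) by ring, Real.rpow_add hs₀, Real.rpow_one]
    rw [hpow, mul_left_comm (1 - s) s, ← mul_assoc (θ ^ 2), mul_assoc t]
    constructor <;> refine mul_le_mul_of_nonneg_right ?_ hp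
    · nlinarith [mul_nonneg (sq_nonneg θ) (sub_nonneg.2 hs₁)]
    · linarith
end

section
/- Let α ∈ (1,2]. Define ρ(t) = min{t², t·(1-t)} (so ρ(t) = t² for t ≤ 1/2 and ρ(t) = t(1-t) for t ≥ 1/2). Then for all (t,s) ∈ (0,1] × (0,1], ρ(t)·G(s,s) ≤ H(t,s) ≤ G(s,s), where G(s,s) = (1-s)·s^(α-1). -/
open Set

theorem stmt4 (α : ℝ) (hα : α ∈ Set.Ioc (1 : ℝ) 2) :
    ∀ t ∈ Set.Ioc (0 : ℝ) 1, ∀ s ∈ Set.Ioc (0 : ℝ) 1,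
      min (t ^ 2) (t * (1 - t)) * ((1 - s) * s ^ (α - 1)) ≤ Hf α t s ∧
        Hf α t s ≤ (1 - s) * s ^ (α - 1) := by
  rintro t ⟨ht0, ht1⟩ s ⟨hs0, hs1⟩
  have h1s : 0 ≤ 1 - s := sub_nonneg.2 hs1
  have h1t : 0 ≤ 1 - t := sub_nonneg.2 ht1
  unfold Hf
  split_ifs with hst
  · have hp : 0 ≤ s ^ (α - 1) := Real.rpow_nonneg hs0.le _
    rw [← mul_assoc]
    refine ⟨mul_le_mul_of_nonneg_right ?_ hp, mul_le_mul_of_nonneg_right ?_ hp⟩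
    · refine (mul_le_mul_of_nonneg_right (min_le_right _ _) h1s).trans ?_
      have : 0 ≤ s * (t * (1 - t)) := by positivity
      linarith
    · linarith [sq_nonneg (1 - t)]
  · have hp : 0 ≤ (1 - s) * s ^ (α - 2) := mul_nonneg h1s (Real.rpow_nonneg hs0.le _)
    have hpow : s ^ (α - 1) = s * s ^ (α - 2) := by
      rw [← Real.rpow_one_add' hs0.le (by linarith [hα.1])]
      ring_nf
    rw [hpow, mul_left_comm (1 - s), mul_assoc (t ^ 2), ← mul_assoc (min _ _)]
    refine ⟨mul_le_mul_of_nonneg_right ?_ hp, mul_le_mul_of_nonneg_right ?_ hp⟩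
    · calc min (t ^ 2) (t * (1 - t)) * s ≤ t ^ 2 * s :=
            mul_le_mul_of_nonneg_right (min_le_left _ _) hs0.le
        _ ≤ t ^ 2 := mul_le_of_le_one_right (sq_nonneg t) hs1
    · exact (pow_le_of_le_one ht0.le ht1 two_ne_zero).trans (not_le.1 hst).le
end

section
/- Let α ∈ (1,2] and let θ ∈ (0, 1/2) be fixed. For all (t,s) ∈ [θ, 1-θ] × (0,1], θ²·G(s,s) ≤ H(t,s) ≤ G(s,s), where G(s,s) = (1-s)·s^(α-1). -/
open Set

theorem stmt5 (α θ : ℝ) (hα : α ∈ Set.Ioc (1 : ℝ) 2) (hθ : θ ∈ Set.Ioo (0 : ℝ) (1 / 2)) :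
    ∀ t ∈ Set.Icc θ (1 - θ), ∀ s ∈ Set.Ioc (0 : ℝ) 1,
      θ ^ 2 * ((1 - s) * s ^ (α - 1)) ≤ Hf α t s ∧
        Hf α t s ≤ (1 - s) * s ^ (α - 1) := by
  rintro t ⟨htl, htu⟩ s ⟨hs0, hs1⟩
  obtain ⟨hθ0, hθ1⟩ := hθ
  have ht0 : 0 < t := hθ0.trans_le htl
  have ht1 : t < 1 := by linarith
  unfold Hf
  split_ifs with hst
  · have hpow : 0 ≤ s ^ (α - 1) := Real.rpow_nonneg hs0.le _
    have hlower : θ ^ 2 * (1 - s) ≤ 2 * t - t ^ 2 - s := by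
      have hθt : 1 - t ≤ 1 - θ ^ 2 := by nlinarith
      have hmul : (1 - t) * (1 - t) ≤ (1 - θ ^ 2) * (1 - s) :=
        mul_le_mul hθt (by linarith) (by linarith) (by linarith)
      linarith
    have hupper : 2 * t - t ^ 2 - s ≤ 1 - s := by nlinarith [sq_nonneg (1 - t)]
    rw [← mul_assoc]
    exact ⟨mul_le_mul_of_nonneg_right hlower hpow, mul_le_mul_of_nonneg_right hupper hpow⟩
  · have hts : t < s := not_le.mp hst
    have hpow : s ^ (α - 1) = s * s ^ (α - 2) := by
      rw [← Real.rpow_one_add' hs0.le (by linarith [hα.1])]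
      ring_nf
    have hnonneg : 0 ≤ (1 - s) * s ^ (α - 2) :=
      mul_nonneg (by linarith) (Real.rpow_nonneg hs0.le _)
    have hlower : θ ^ 2 * s ≤ t ^ 2 := by nlinarith [sq_nonneg θ]
    have hupper : t ^ 2 ≤ s := by nlinarith
    rw [hpow]
    constructor
    · linarith [mul_le_mul_of_nonneg_right hlower hnonneg]
    · linarith [mul_le_mul_of_nonneg_right hupper hnonneg]
end

section
/- Let α ∈ (1,2], η ∈ (0,1], 0 ≤ λ < 2/η², and let θ ∈ (0, 1/2) be fixed. Let h : [0,1] → [0,∞) be continuous and define x(t) = ∫₀¹ K(t,s) h(s) ds for t ∈ [0,1]. Then x(t) ≥ 0 for all t ∈ [0,1], and min_{t∈[θ,1-θ]} x(t) ≥ θ²·‖x‖, where ‖x‖ = sup_{t∈[0,1]} |x(t)|. -/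
open Set MeasureTheory

theorem Gf_eq_rpow_mul (α t : ℝ) {s : ℝ} (hs : 0 < s) :
    Gf α t s = s ^ (α - 2) * (min t s * (1 - max t s)) := by
  have e : s ^ (α - 1) = s ^ (α - 2) * s := by
    rw [← Real.rpow_add_one hs.ne']; ring_nf
  unfold Gf
  split_ifs with hst
  · rw [min_eq_right hst, max_eq_left hst, e]; ring
  · rw [min_eq_left (not_le.mp hst).le, max_eq_right (not_le.mp hst).le]; ring

theorem Hf_eq_rpow_mul (α t : ℝ) {s : ℝ} (hs : 0 < s) :
    Hf α t s = s ^ (α - 2) * (t ^ 2 * (1 - s) - max (t - s) 0 ^ 2) := by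
  have e : s ^ (α - 1) = s ^ (α - 2) * s := by
    rw [← Real.rpow_add_one hs.ne']; ring_nf
  unfold Hf
  split_ifs with hst
  · rw [max_eq_left (sub_nonneg.mpr hst), e]; ring
  · rw [max_eq_right (by linarith)]; ring

theorem Gf_nonneg (α : ℝ) {t s : ℝ} (ht : t ∈ Icc (0 : ℝ) 1) (hs : s ∈ Ioc (0 : ℝ) 1) :
    0 ≤ Gf α t s := by
  rw [Gf_eq_rpow_mul α t hs.1]
  exact mul_nonneg (Real.rpow_nonneg hs.1.le _)
    (mul_nonneg (le_min ht.1 hs.1.le) (sub_nonneg.mpr (max_le ht.2 hs.2)))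

theorem Hf_nonneg (α : ℝ) {t s : ℝ} (ht : t ∈ Icc (0 : ℝ) 1) (hs : s ∈ Ioc (0 : ℝ) 1) :
    0 ≤ Hf α t s := by
  obtain ⟨ht0, ht1⟩ := ht
  obtain ⟨hs0, hs1⟩ := hs
  unfold Hf
  split_ifs with hst
  · exact mul_nonneg (by nlinarith) (Real.rpow_nonneg hs0.le _)
  · exact mul_nonneg (mul_nonneg (sq_nonneg t) (by linarith)) (Real.rpow_nonneg hs0.le _)

theorem mul_Gf_le_Gf (α : ℝ) {θ t u s : ℝ} (hθ : 0 ≤ θ) (ht : t ∈ Icc θ (1 - θ))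
    (hs : s ∈ Ioc (0 : ℝ) 1) : θ * Gf α u s ≤ Gf α t s := by
  obtain ⟨ht0, ht1⟩ := ht
  obtain ⟨hs0, hs1⟩ := hs
  rw [Gf_eq_rpow_mul α u hs0, Gf_eq_rpow_mul α t hs0, mul_left_comm]
  refine mul_le_mul_of_nonneg_left ?_ (Real.rpow_nonneg hs0.le _)
  have hu : min u s * (1 - max u s) ≤ s * (1 - s) := by
    rcases le_total u s with hus | hus
    · rw [min_eq_left hus, max_eq_right hus]; nlinarith
    · rw [min_eq_right hus, max_eq_left hus]; nlinarith
  have hmid : θ * (s * (1 - s)) ≤ min t s * (1 - max t s) := by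
    rcases le_total t s with hts | hts
    · rw [min_eq_left hts, max_eq_right hts, ← mul_assoc]
      exact mul_le_mul_of_nonneg_right (by nlinarith) (by linarith)
    · rw [min_eq_right hts, max_eq_left hts, mul_left_comm]
      exact mul_le_mul_of_nonneg_left (by nlinarith) hs0.le
  exact (mul_le_mul_of_nonneg_left hu hθ).trans hmid

theorem Kf_nonneg (α : ℝ) {η lam t s : ℝ} (hη : η ∈ Icc (0 : ℝ) 1) (hlam0 : 0 ≤ lam)
    (hlam : 0 ≤ 2 - lam * η ^ 2) (ht : t ∈ Icc (0 : ℝ) 1) (hs : s ∈ Ioc (0 : ℝ) 1) :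
    0 ≤ Kf α η lam t s :=
  add_nonneg (Gf_nonneg α ht hs)
    (mul_nonneg (div_nonneg (mul_nonneg hlam0 ht.1) hlam) (Hf_nonneg α hη hs))

theorem mul_Kf_le_Kf (α : ℝ) {η lam θ t u s : ℝ} (hη : η ∈ Icc (0 : ℝ) 1) (hlam0 : 0 ≤ lam)
    (hlam : 0 ≤ 2 - lam * η ^ 2) (hθ : 0 ≤ θ) (ht : t ∈ Icc θ (1 - θ)) (hu : u ≤ 1)
    (hs : s ∈ Ioc (0 : ℝ) 1) : θ * Kf α η lam u s ≤ Kf α η lam t s := by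
  unfold Kf
  have hut : θ * u ≤ t := (mul_le_of_le_one_right hθ hu).trans ht.1
  have hcoef : θ * (lam * u / (2 - lam * η ^ 2)) ≤ lam * t / (2 - lam * η ^ 2) := by
    rw [← mul_div_assoc, mul_left_comm]
    exact div_le_div_of_nonneg_right (mul_le_mul_of_nonneg_left hut hlam0) hlam
  rw [mul_add, ← mul_assoc θ (_ / _)]
  exact add_le_add (mul_Gf_le_Gf α hθ ht hs)
    (mul_le_mul_of_nonneg_right hcoef (Hf_nonneg α hη hs))

theorem intervalIntegrable_Kf_mul {α : ℝ} (hα : 1 < α) (η lam t : ℝ) {h : ℝ → ℝ}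
    (hh : ContinuousOn h (Icc 0 1)) :
    IntervalIntegrable (fun s => Kf α η lam t s * h s) volume 0 1 := by
  have hpow : IntervalIntegrable (fun s : ℝ => s ^ (α - 2)) volume 0 1 :=
    intervalIntegral.intervalIntegrable_rpow' (by linarith)
  have hcont : ContinuousOn (fun s => (min t s * (1 - max t s) + lam * t / (2 - lam * η ^ 2) *
      (η ^ 2 * (1 - s) - max (η - s) 0 ^ 2)) * h s) (uIcc 0 1) := by
    rw [uIcc_of_le zero_le_one]
    exact ContinuousOn.mul (Continuous.continuousOn (by fun_prop)) hh
  refine (hpow.mul_continuousOn hcont).congr fun s hs => ?_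
  rw [uIoc_of_le zero_le_one] at hs
  simp only [Kf, Gf_eq_rpow_mul α t hs.1, Hf_eq_rpow_mul α η hs.1]
  ring

theorem stmt6 (α η lam θ : ℝ) (hα : α ∈ Set.Ioc (1 : ℝ) 2) (hη : η ∈ Set.Ioc (0 : ℝ) 1)
    (hlam0 : 0 ≤ lam) (hlam : lam < 2 / η ^ 2) (hθ : θ ∈ Set.Ioo (0 : ℝ) (1 / 2))
    (h : ℝ → ℝ) (hh : ContinuousOn h (Set.Icc 0 1)) (hpos : ∀ t ∈ Set.Icc (0 : ℝ) 1, 0 ≤ h t)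
    (x : ℝ → ℝ) (hx : ∀ t, x t = ∫ s in (0 : ℝ)..1, Kf α η lam t s * h s) :
    (∀ t ∈ Set.Icc (0 : ℝ) 1, 0 ≤ x t) ∧
    ∀ t ∈ Set.Icc θ (1 - θ),
      θ ^ 2 * sSup ((fun u => |x u|) '' Set.Icc (0 : ℝ) 1) ≤ x t := by
  have hη' : η ∈ Icc (0 : ℝ) 1 := Ioc_subset_Icc_self hη
  have hden : 0 ≤ 2 - lam * η ^ 2 :=
    sub_nonneg.mpr ((lt_div_iff₀ (pow_pos hη.1 2)).mp hlam).le
  have hx0 : ∀ t ∈ Icc (0 : ℝ) 1, 0 ≤ x t := fun t ht => by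
    rw [hx, intervalIntegral.integral_of_le zero_le_one]
    exact setIntegral_nonneg measurableSet_Ioc fun s hs =>
      mul_nonneg (Kf_nonneg α hη' hlam0 hden ht hs) (hpos s (Ioc_subset_Icc_self hs))
  refine ⟨hx0, fun t ht => ?_⟩
  obtain ⟨hθ0, hθ1⟩ := hθ
  have harnack : ∀ u ∈ Icc (0 : ℝ) 1, θ * x u ≤ x t := fun u hu => by
    rw [hx, hx, ← intervalIntegral.integral_const_mul]
    refine intervalIntegral.integral_mono_on_of_le_Ioo zero_le_one
      ((intervalIntegrable_Kf_mul hα.1 η lam u hh).const_mul θ)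
      (intervalIntegrable_Kf_mul hα.1 η lam t hh) fun s hs => ?_
    rw [← mul_assoc]
    exact mul_le_mul_of_nonneg_right
      (mul_Kf_le_Kf α hη' hlam0 hden hθ0.le ht hu.2 (Ioo_subset_Ioc_self hs))
      (hpos s (Ioo_subset_Icc_self hs))
  rw [mul_comm, ← le_div_iff₀ (pow_pos hθ0 2)]
  refine csSup_le ((nonempty_Icc.mpr zero_le_one).image _) ?_
  rintro _ ⟨u, hu, rfl⟩
  simp only [abs_of_nonneg (hx0 u hu)]
  rw [le_div_iff₀ (pow_pos hθ0 2)]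
  nlinarith [harnack u hu, mul_nonneg hθ0.le (hx0 u hu)]
end

section
/- Let α ∈ (1,2], η ∈ (0,1], 0 ≤ λ < 2/η², and let θ ∈ (0, 1/2) be fixed. Let h : [0,1] → [0,∞) be continuous and define x(t) = ∫₀¹ K(t,s) h(s) ds for t ∈ [0,1]. Then: (a) ‖x‖ ≤ ∫₀¹ G(s,s) h(s) ds + (λ/(2-λη²))·∫₀¹ H(η,s) h(s) ds, where ‖x‖ = sup_{t∈[0,1]} |x(t)| and G(s,s) = (1-s)·s^(α-1); and (b) for every t ∈ [θ, 1-θ], x(t) ≥ θ²·(∫₀¹ G(s,s) h(s) ds + (λ/(2-λη²))·∫₀¹ H(η,s) h(s) ds). -/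
open Set MeasureTheory

/-- On the unit interval `G` is nonnegative and dominated by its diagonal. -/
lemma Gf_nonneg_and_le_diag {α t s : ℝ} (ht : t ∈ Icc (0 : ℝ) 1) (hs : s ∈ Ioc (0 : ℝ) 1) :
    0 ≤ Gf α t s ∧ Gf α t s ≤ (1 - s) * s ^ (α - 1) := by
  obtain ⟨ht0, ht1⟩ := ht
  obtain ⟨hs0, hs1⟩ := hs
  have hp : s ^ (α - 1) = s * s ^ (α - 2) := by
    rw [mul_comm, ← Real.rpow_add_one hs0.ne']; ring_nf
  have hq : 0 ≤ s ^ (α - 2) := Real.rpow_nonneg hs0.le _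
  have h1 : 0 ≤ 1 - s := by linarith
  have h2 : 0 ≤ 1 - t := by linarith
  unfold Gf
  split_ifs with hst
  · exact ⟨by positivity, by gcongr⟩
  · refine ⟨by positivity, ?_⟩
    rw [hp, mul_comm t, mul_assoc]
    gcongr
    exact (not_le.mp hst).le

/-- On `[θ, 1 - θ]` the kernel `G` is bounded below by `θ` times its diagonal. -/
lemma mul_diag_le_Gf {α θ t s : ℝ} (hθ : 0 ≤ θ) (ht : t ∈ Icc θ (1 - θ))
    (hs : s ∈ Ioc (0 : ℝ) 1) : θ * ((1 - s) * s ^ (α - 1)) ≤ Gf α t s := by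
  obtain ⟨ht0, ht1⟩ := ht
  obtain ⟨hs0, hs1⟩ := hs
  have hp : s ^ (α - 1) = s * s ^ (α - 2) := by
    rw [mul_comm, ← Real.rpow_add_one hs0.ne']; ring_nf
  have hq : 0 ≤ s ^ (α - 2) := Real.rpow_nonneg hs0.le _
  have hq' : 0 ≤ s ^ (α - 1) := Real.rpow_nonneg hs0.le _
  have h1 : 0 ≤ 1 - s := by linarith
  unfold Gf
  split_ifs with hst
  · rw [← mul_assoc]
    gcongr
    nlinarith
  · rw [hp, ← mul_assoc]
    gcongr
    · exact mul_nonneg (hθ.trans ht0) h1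
    · exact mul_le_of_le_one_left hq hs1

/-- On the unit interval `H` takes values in `[0, 1]`. -/
lemma Hf_mem_Icc {α t s : ℝ} (hα : 1 ≤ α) (ht : t ∈ Icc (0 : ℝ) 1)
    (hs : s ∈ Ioc (0 : ℝ) 1) : Hf α t s ∈ Icc (0 : ℝ) 1 := by
  obtain ⟨ht0, ht1⟩ := ht
  obtain ⟨hs0, hs1⟩ := hs
  have hp : s ^ (α - 1) = s * s ^ (α - 2) := by
    rw [mul_comm, ← Real.rpow_add_one hs0.ne']; ring_nf
  have hq : 0 ≤ s ^ (α - 2) := Real.rpow_nonneg hs0.le _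
  have hq' : 0 ≤ s ^ (α - 1) := Real.rpow_nonneg hs0.le _
  have hle : s ^ (α - 1) ≤ 1 := Real.rpow_le_one hs0.le hs1 (by linarith)
  have h1 : 0 ≤ 1 - s := by linarith
  unfold Hf
  split_ifs with hst
  · have hc : 0 ≤ 2 * t - t ^ 2 - s := by nlinarith
    exact ⟨by positivity, mul_le_one₀ (by nlinarith [sq_nonneg (t - 1)]) hq' hle⟩
  · refine ⟨by positivity, ?_⟩
    have hts : t ^ 2 * (1 - s) ≤ s := by
      nlinarith [mul_nonneg (sq_nonneg t) hs0.le]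
    calc t ^ 2 * (1 - s) * s ^ (α - 2) ≤ s * s ^ (α - 2) := by gcongr
      _ ≤ 1 := hp ▸ hle

lemma measurable_Gf (α t : ℝ) : Measurable (Gf α t) :=
  Measurable.ite measurableSet_Iic (by fun_prop) (by fun_prop)

lemma measurable_Hf (α t : ℝ) : Measurable (Hf α t) :=
  Measurable.ite measurableSet_Iic (by fun_prop) (by fun_prop)

/-- A measurable `[0, 1]`-valued weight times a continuous function is integrable. -/
lemma intervalIntegrable_mul_of_mem_Icc {f h : ℝ → ℝ} (hf : Measurable f)
    (hf01 : ∀ s ∈ Ioc (0 : ℝ) 1, f s ∈ Icc (0 : ℝ) 1) (hh : ContinuousOn h (Icc 0 1)) :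
    IntervalIntegrable (fun s => f s * h s) volume 0 1 := by
  rw [intervalIntegrable_iff_integrableOn_Ioc_of_le zero_le_one]
  have hi : IntegrableOn h (Ioc 0 1) :=
    (hh.integrableOn_compact isCompact_Icc).mono_set Ioc_subset_Icc_self
  refine hi.bdd_mul (c := 1) hf.aestronglyMeasurable ?_
  filter_upwards [ae_restrict_mem measurableSet_Ioc] with s hs
  rw [Real.norm_of_nonneg (hf01 s hs).1]
  exact (hf01 s hs).2

theorem stmt7 (α η lam θ : ℝ) (hα : α ∈ Set.Ioc (1 : ℝ) 2) (hη : η ∈ Set.Ioc (0 : ℝ) 1)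
    (hlam0 : 0 ≤ lam) (hlam : lam < 2 / η ^ 2) (hθ : θ ∈ Set.Ioo (0 : ℝ) (1 / 2))
    (h : ℝ → ℝ) (hh : ContinuousOn h (Set.Icc 0 1)) (hpos : ∀ t ∈ Set.Icc (0 : ℝ) 1, 0 ≤ h t)
    (x : ℝ → ℝ) (hx : ∀ t, x t = ∫ s in (0 : ℝ)..1, Kf α η lam t s * h s) :
    sSup ((fun u => |x u|) '' Set.Icc (0 : ℝ) 1) ≤
      (∫ s in (0 : ℝ)..1, (1 - s) * s ^ (α - 1) * h s) +
        lam / (2 - lam * η ^ 2) * ∫ s in (0 : ℝ)..1, Hf α η s * h s ∧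
    ∀ t ∈ Set.Icc θ (1 - θ),
      θ ^ 2 * ((∫ s in (0 : ℝ)..1, (1 - s) * s ^ (α - 1) * h s) +
        lam / (2 - lam * η ^ 2) * ∫ s in (0 : ℝ)..1, Hf α η s * h s) ≤ x t := by
  obtain ⟨hα1, -⟩ := hα
  obtain ⟨hθ0, hθ1⟩ := hθ
  have hη' : η ∈ Icc (0 : ℝ) 1 := Ioc_subset_Icc_self hη
  have hden : 0 < 2 - lam * η ^ 2 := by
    have := (lt_div_iff₀ (pow_pos hη.1 2)).mp hlam
    linarith
  set c := lam / (2 - lam * η ^ 2) with hc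
  have hc0 : 0 ≤ c := div_nonneg hlam0 hden.le
  have hdiag : ∀ s ∈ Ioc (0 : ℝ) 1, (1 - s) * s ^ (α - 1) ∈ Icc (0 : ℝ) 1 := fun s hs =>
    have hp : 0 ≤ s ^ (α - 1) := Real.rpow_nonneg hs.1.le _
    ⟨mul_nonneg (by linarith [hs.2]) hp,
      mul_le_one₀ (by linarith [hs.1]) hp (Real.rpow_le_one hs.1.le hs.2 (by linarith))⟩
  have hiD : IntervalIntegrable (fun s => (1 - s) * s ^ (α - 1) * h s) volume 0 1 :=
    intervalIntegrable_mul_of_mem_Icc (by fun_prop) hdiag hh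
  have hiH : IntervalIntegrable (fun s => Hf α η s * h s) volume 0 1 :=
    intervalIntegrable_mul_of_mem_Icc (measurable_Hf α η)
      (fun s hs => Hf_mem_Icc hα1.le hη' hs) hh
  have hiG : ∀ t ∈ Icc (0 : ℝ) 1, IntervalIntegrable (fun s => Gf α t s * h s) volume 0 1 :=
    fun t ht => intervalIntegrable_mul_of_mem_Icc (measurable_Gf α t)
      (fun s hs => ⟨(Gf_nonneg_and_le_diag ht hs).1,
        (Gf_nonneg_and_le_diag ht hs).2.trans (hdiag s hs).2⟩) hh
  have hh0 : ∀ s ∈ Ioc (0 : ℝ) 1, 0 ≤ h s := fun s hs => hpos s (Ioc_subset_Icc_self hs)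
  have mono : ∀ {f g : ℝ → ℝ}, IntervalIntegrable f volume 0 1 →
      IntervalIntegrable g volume 0 1 → (∀ s ∈ Ioc (0 : ℝ) 1, f s ≤ g s) →
      ∫ s in (0 : ℝ)..1, f s ≤ ∫ s in (0 : ℝ)..1, g s := fun hf hg hfg =>
    intervalIntegral.integral_mono_on_of_le_Ioo zero_le_one hf hg
      fun s hs => hfg s (Ioo_subset_Ioc_self hs)
  have hxt : ∀ t ∈ Icc (0 : ℝ) 1, x t = (∫ s in (0 : ℝ)..1, Gf α t s * h s) +
      t * (c * ∫ s in (0 : ℝ)..1, Hf α η s * h s) := by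
    intro t ht
    rw [hx, ← mul_assoc, ← intervalIntegral.integral_const_mul,
      ← intervalIntegral.integral_add (hiG t ht) (hiH.const_mul _)]
    congr 1 with s
    simp only [Kf, hc]
    ring
  have hJ : 0 ≤ c * ∫ s in (0 : ℝ)..1, Hf α η s * h s := by
    refine mul_nonneg hc0 ?_
    simpa using mono (f := fun _ => 0) (by simp) hiH
      fun s hs => mul_nonneg (Hf_mem_Icc hα1.le hη' hs).1 (hh0 s hs)
  have hD : 0 ≤ ∫ s in (0 : ℝ)..1, (1 - s) * s ^ (α - 1) * h s := by
    simpa using mono (f := fun _ => 0) (by simp) hiD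
      fun s hs => mul_nonneg (hdiag s hs).1 (hh0 s hs)
  refine ⟨csSup_le ((nonempty_Icc.mpr zero_le_one).image _) ?_, fun t ht => ?_⟩
  · rintro _ ⟨t, ht, rfl⟩
    have hG0 : 0 ≤ ∫ s in (0 : ℝ)..1, Gf α t s * h s := by
      simpa using mono (f := fun _ => 0) (by simp) (hiG t ht)
        fun s hs => mul_nonneg (Gf_nonneg_and_le_diag ht hs).1 (hh0 s hs)
    have hGD := mono (hiG t ht) hiD fun s hs =>
      mul_le_mul_of_nonneg_right (Gf_nonneg_and_le_diag ht hs).2 (hh0 s hs)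
    have hxt0 : 0 ≤ x t := hxt t ht ▸ add_nonneg hG0 (mul_nonneg ht.1 hJ)
    change |x t| ≤ _
    rw [abs_of_nonneg hxt0, hxt t ht]
    exact add_le_add hGD (mul_le_of_le_one_left hJ ht.2)
  · have ht' : t ∈ Icc (0 : ℝ) 1 := ⟨hθ0.le.trans ht.1, ht.2.trans (by linarith)⟩
    have hDG := mono (hiD.const_mul θ) (hiG t ht') fun s hs => by
      rw [← mul_assoc]
      exact mul_le_mul_of_nonneg_right (mul_diag_le_Gf hθ0.le ht hs) (hh0 s hs)
    rw [intervalIntegral.integral_const_mul] at hDG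
    have hsq : θ ^ 2 ≤ θ := by nlinarith
    rw [hxt t ht', mul_add]
    exact add_le_add ((mul_le_mul_of_nonneg_right hsq hD).trans hDG)
      (mul_le_mul_of_nonneg_right (hsq.trans ht.1) hJ)
end

section
/- Let α ∈ (1,2], η ∈ (0,1], 0 ≤ λ < 2/η², let θ ∈ (0, 1/2) be fixed, and let f : [0,1] × [0,∞) → [0,∞) be continuous. A continuous function x : [0,1] → [0,∞) is a nonnegative solution of the boundary value problem t^(2-α)·x''(t) + f(t, x(t)) = 0 for t ∈ (0,1) (with x twice differentiable on (0,1)), x(0) = 0, x(1) = λ·∫₀^η x(t) dt, if and only if x belongs to the cone P and satisfies x = Ax, i.e., x(t) = ∫₀¹ K(t,s) f(s, x(s)) ds for all t ∈ [0,1]. -/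
open Set MeasureTheory

/-- The solution of `-u'' = g`, `u 0 = u 1 = 0` on `[0, 1]`. -/
noncomputable def dirichletSol (g : ℝ → ℝ) (t : ℝ) : ℝ :=
  (1 - t) * (∫ s in (0 : ℝ)..t, s * g s) + t * ∫ s in t..1, (1 - s) * g s

/-- Twice the primitive of `dirichletSol g` that vanishes at `0`. -/
noncomputable def dirichletPrim (g : ℝ → ℝ) (t : ℝ) : ℝ :=
  ((2 * t - t ^ 2) * (∫ s in (0 : ℝ)..t, s * g s) - ∫ s in (0 : ℝ)..t, s ^ 2 * g s)
    + t ^ 2 * ∫ s in t..1, (1 - s) * g s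

section Primitives

variable {g : ℝ → ℝ}

lemma continuousOn_integral_zero_left (hg : IntervalIntegrable g volume 0 1) :
    ContinuousOn (fun t => ∫ s in (0 : ℝ)..t, g s) (Icc 0 1) := by
  have h := intervalIntegral.continuousOn_primitive_interval (μ := volume) (f := g)
    (a := 0) (b := 1) (by
      rw [uIcc_of_le zero_le_one]
      exact (intervalIntegrable_iff_integrableOn_Icc_of_le zero_le_one).1 hg)
  rwa [uIcc_of_le zero_le_one] at h

lemma integral_right_eq_sub (hg : IntervalIntegrable g volume 0 1) {t : ℝ}
    (ht : t ∈ Icc (0 : ℝ) 1) :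
    ∫ s in t..1, g s = (∫ s in (0 : ℝ)..1, g s) - ∫ s in (0 : ℝ)..t, g s := by
  have hsub : uIcc 0 t ⊆ uIcc (0 : ℝ) 1 := by
    rw [uIcc_of_le ht.1, uIcc_of_le zero_le_one]; exact Icc_subset_Icc_right ht.2
  exact (intervalIntegral.integral_interval_sub_left hg (hg.mono_set hsub)).symm

lemma continuousOn_integral_one_right (hg : IntervalIntegrable g volume 0 1) :
    ContinuousOn (fun t => ∫ s in t..1, g s) (Icc 0 1) :=
  (continuousOn_const.sub (continuousOn_integral_zero_left hg)).congr
    fun _ ht => integral_right_eq_sub hg ht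

lemma hasDerivAt_integral_zero_left (hg : IntervalIntegrable g volume 0 1)
    (hgc : ContinuousOn g (Ioo 0 1)) {t : ℝ} (ht : t ∈ Ioo (0 : ℝ) 1) :
    HasDerivAt (fun t => ∫ s in (0 : ℝ)..t, g s) (g t) t := by
  have hsub : uIcc 0 t ⊆ uIcc (0 : ℝ) 1 := by
    rw [uIcc_of_le ht.1.le, uIcc_of_le zero_le_one]; exact Icc_subset_Icc_right ht.2.le
  exact intervalIntegral.integral_hasDerivAt_right (hg.mono_set hsub)
    (hgc.stronglyMeasurableAtFilter isOpen_Ioo t ht) (hgc.continuousAt (isOpen_Ioo.mem_nhds ht))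

lemma hasDerivAt_integral_one_right (hg : IntervalIntegrable g volume 0 1)
    (hgc : ContinuousOn g (Ioo 0 1)) {t : ℝ} (ht : t ∈ Ioo (0 : ℝ) 1) :
    HasDerivAt (fun t => ∫ s in t..1, g s) (-g t) t := by
  refine ((hasDerivAt_integral_zero_left hg hgc ht).const_sub
    (∫ s in (0 : ℝ)..1, g s)).congr_of_eventuallyEq ?_
  filter_upwards [isOpen_Ioo.mem_nhds ht] with s hs
  exact integral_right_eq_sub hg (Ioo_subset_Icc_self hs)

lemma integral_ite_le {a b : ℝ → ℝ} (ha : IntervalIntegrable a volume 0 1)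
    (hb : IntervalIntegrable b volume 0 1) {t : ℝ} (ht : t ∈ Icc (0 : ℝ) 1) :
    IntervalIntegrable (fun s => if s ≤ t then a s else b s) volume 0 1 ∧
    ∫ s in (0 : ℝ)..1, (if s ≤ t then a s else b s) =
      (∫ s in (0 : ℝ)..t, a s) + ∫ s in t..1, b s := by
  have hsub : uIcc 0 t ⊆ uIcc (0 : ℝ) 1 := by
    rw [uIcc_of_le ht.1, uIcc_of_le zero_le_one]; exact Icc_subset_Icc_right ht.2
  have hsub' : uIcc t 1 ⊆ uIcc (0 : ℝ) 1 := by
    rw [uIcc_of_le ht.2, uIcc_of_le zero_le_one]; exact Icc_subset_Icc_left ht.1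
  have e1 : EqOn a (fun s => if s ≤ t then a s else b s) (uIoc 0 t) := by
    intro s hs
    rw [uIoc_of_le ht.1] at hs
    simp [hs.2]
  have e2 : EqOn b (fun s => if s ≤ t then a s else b s) (uIoc t 1) := by
    intro s hs
    rw [uIoc_of_le ht.2] at hs
    simp [not_le.2 hs.1]
  have i1 := (ha.mono_set hsub).congr e1
  have i2 := (hb.mono_set hsub').congr e2
  refine ⟨i1.trans i2, ?_⟩
  rw [← intervalIntegral.integral_add_adjacent_intervals i1 i2,
    intervalIntegral.integral_congr_ae (.of_forall fun _ h => e1 h),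
    intervalIntegral.integral_congr_ae (.of_forall fun _ h => e2 h)]

end Primitives

section Dirichlet

variable {g : ℝ → ℝ}

@[simp] lemma dirichletSol_zero : dirichletSol g 0 = 0 := by simp [dirichletSol]

@[simp] lemma dirichletSol_one : dirichletSol g 1 = 0 := by simp [dirichletSol]

@[simp] lemma dirichletPrim_zero : dirichletPrim g 0 = 0 := by simp [dirichletPrim]

lemma IntervalIntegrable.id_mul (hg : IntervalIntegrable g volume 0 1) :
    IntervalIntegrable (fun s => s * g s) volume 0 1 :=
  hg.continuousOn_mul (g := fun s => s) (by fun_prop)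

lemma IntervalIntegrable.sq_mul (hg : IntervalIntegrable g volume 0 1) :
    IntervalIntegrable (fun s => s ^ 2 * g s) volume 0 1 :=
  hg.continuousOn_mul (g := fun s => s ^ 2) (by fun_prop)

lemma IntervalIntegrable.one_sub_mul (hg : IntervalIntegrable g volume 0 1) :
    IntervalIntegrable (fun s => (1 - s) * g s) volume 0 1 :=
  hg.continuousOn_mul (g := fun s => 1 - s) (by fun_prop)

lemma continuousOn_dirichletSol (hg : IntervalIntegrable g volume 0 1) :
    ContinuousOn (dirichletSol g) (Icc 0 1) := by
  have h1 := continuousOn_integral_zero_left hg.id_mul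
  have h2 := continuousOn_integral_one_right hg.one_sub_mul
  unfold dirichletSol
  fun_prop

lemma continuousOn_dirichletPrim (hg : IntervalIntegrable g volume 0 1) :
    ContinuousOn (dirichletPrim g) (Icc 0 1) := by
  have h1 := continuousOn_integral_zero_left hg.id_mul
  have h2 := continuousOn_integral_one_right hg.one_sub_mul
  have h3 := continuousOn_integral_zero_left hg.sq_mul
  unfold dirichletPrim
  fun_prop

lemma hasDerivAt_dirichletSol (hg : IntervalIntegrable g volume 0 1)
    (hgc : ContinuousOn g (Ioo 0 1)) {t : ℝ} (ht : t ∈ Ioo (0 : ℝ) 1) :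
    HasDerivAt (dirichletSol g)
      ((∫ s in t..1, (1 - s) * g s) - ∫ s in (0 : ℝ)..t, s * g s) t := by
  have h1 := hasDerivAt_integral_zero_left hg.id_mul (by fun_prop) ht
  have h2 := hasDerivAt_integral_one_right hg.one_sub_mul (by fun_prop) ht
  refine ((((hasDerivAt_id' t).const_sub 1).fun_mul h1).fun_add
    ((hasDerivAt_id' t).fun_mul h2)).congr_deriv ?_
  ring

lemma hasDerivAt_deriv_dirichletSol (hg : IntervalIntegrable g volume 0 1)
    (hgc : ContinuousOn g (Ioo 0 1)) {t : ℝ} (ht : t ∈ Ioo (0 : ℝ) 1) :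
    HasDerivAt (deriv (dirichletSol g)) (-g t) t := by
  have h1 := hasDerivAt_integral_zero_left hg.id_mul (by fun_prop) ht
  have h2 := hasDerivAt_integral_one_right hg.one_sub_mul (by fun_prop) ht
  refine ((h2.fun_sub h1).congr_deriv (by ring)).congr_of_eventuallyEq ?_
  filter_upwards [isOpen_Ioo.mem_nhds ht] with s hs
  exact (hasDerivAt_dirichletSol hg hgc hs).deriv

lemma hasDerivAt_dirichletPrim (hg : IntervalIntegrable g volume 0 1)
    (hgc : ContinuousOn g (Ioo 0 1)) {t : ℝ} (ht : t ∈ Ioo (0 : ℝ) 1) :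
    HasDerivAt (dirichletPrim g) (2 * dirichletSol g t) t := by
  have h1 := hasDerivAt_integral_zero_left hg.id_mul (by fun_prop) ht
  have h2 := hasDerivAt_integral_one_right hg.one_sub_mul (by fun_prop) ht
  have h3 := hasDerivAt_integral_zero_left hg.sq_mul (by fun_prop) ht
  have h4 : HasDerivAt (fun t : ℝ => t ^ 2) (2 * t) t := by simpa using hasDerivAt_pow 2 t
  refine ((((((hasDerivAt_id' t).const_mul 2).fun_sub h4).fun_mul h1).fun_sub h3).fun_add
    (h4.fun_mul h2)).congr_deriv ?_
  simp only [dirichletSol]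
  ring

lemma integral_dirichletSol (hg : IntervalIntegrable g volume 0 1)
    (hgc : ContinuousOn g (Ioo 0 1)) {η : ℝ} (hη : η ∈ Icc (0 : ℝ) 1) :
    2 * ∫ t in (0 : ℝ)..η, dirichletSol g t = dirichletPrim g η := by
  have hsub : Icc 0 η ⊆ Icc (0 : ℝ) 1 := Icc_subset_Icc_right hη.2
  rw [← intervalIntegral.integral_const_mul,
    intervalIntegral.integral_eq_sub_of_hasDerivAt_of_le hη.1
      ((continuousOn_dirichletPrim hg).mono hsub)
      (fun t ht => hasDerivAt_dirichletPrim hg hgc ⟨ht.1, ht.2.trans_le hη.2⟩)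
      ((((continuousOn_dirichletSol hg).mono hsub).intervalIntegrable_of_Icc hη.1).const_mul 2),
    dirichletPrim_zero, sub_zero]

lemma integral_Kf_mul {α η lam t : ℝ} {φ : ℝ → ℝ}
    (hg : IntervalIntegrable (fun s => s ^ (α - 2) * φ s) volume 0 1)
    (hη : η ∈ Icc (0 : ℝ) 1) (ht : t ∈ Icc (0 : ℝ) 1) :
    ∫ s in (0 : ℝ)..1, Kf α η lam t s * φ s =
      dirichletSol (fun s => s ^ (α - 2) * φ s) t + lam * t / (2 - lam * η ^ 2) *
        dirichletPrim (fun s => s ^ (α - 2) * φ s) η := by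
  have key : EqOn (fun s => Kf α η lam t s * φ s) (fun s =>
      (if s ≤ t then (1 - t) * (s * (s ^ (α - 2) * φ s))
        else t * ((1 - s) * (s ^ (α - 2) * φ s))) +
      lam * t / (2 - lam * η ^ 2) *
        (if s ≤ η then (2 * η - η ^ 2) * (s * (s ^ (α - 2) * φ s)) - s ^ 2 * (s ^ (α - 2) * φ s)
          else η ^ 2 * ((1 - s) * (s ^ (α - 2) * φ s)))) (uIoc 0 1) := by
    intro s hs
    rw [uIoc_of_le zero_le_one] at hs
    have hpow : s ^ (α - 1) = s * s ^ (α - 2) := by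
      rw [show α - 1 = 1 + (α - 2) by ring, Real.rpow_add hs.1, Real.rpow_one]
    simp only [Kf, Gf, Hf, hpow]
    split_ifs <;> ring
  obtain ⟨i1, e1⟩ := integral_ite_le (hg.id_mul.const_mul (1 - t)) (hg.one_sub_mul.const_mul t) ht
  obtain ⟨i2, e2⟩ := integral_ite_le ((hg.id_mul.const_mul (2 * η - η ^ 2)).sub hg.sq_mul)
    (hg.one_sub_mul.const_mul (η ^ 2)) hη
  have hsub : uIcc 0 η ⊆ uIcc (0 : ℝ) 1 := by
    rw [uIcc_of_le hη.1, uIcc_of_le zero_le_one]; exact Icc_subset_Icc_right hη.2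
  rw [intervalIntegral.integral_congr_ae (.of_forall fun _ h => key h),
    intervalIntegral.integral_add i1 (i2.const_mul _), intervalIntegral.integral_const_mul,
    e1, e2, intervalIntegral.integral_sub ((hg.id_mul.mono_set hsub).const_mul _)
      (hg.sq_mul.mono_set hsub)]
  simp only [intervalIntegral.integral_const_mul, dirichletSol, dirichletPrim]

end Dirichlet

lemma eq_lineMap_of_deriv2_eq_zero {y : ℝ → ℝ} (hc : ContinuousOn y (Icc 0 1))
    (hd : ∀ t ∈ Ioo (0 : ℝ) 1, DifferentiableAt ℝ y t)
    (hd2 : ∀ t ∈ Ioo (0 : ℝ) 1, HasDerivAt (deriv y) 0 t) {t : ℝ} (ht : t ∈ Icc (0 : ℝ) 1) :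
    y t = (1 - t) * y 0 + t * y 1 := by
  have h1 : DifferentiableOn ℝ y (interior (Icc 0 1)) := by
    rw [interior_Icc]; exact fun s hs => (hd s hs).differentiableWithinAt
  have h2 : DifferentiableOn ℝ (deriv y) (interior (Icc 0 1)) := by
    rw [interior_Icc]; exact fun s hs => (hd2 s hs).differentiableAt.differentiableWithinAt
  have h3 : ∀ s ∈ interior (Icc (0 : ℝ) 1), deriv^[2] y s = 0 := by
    rw [interior_Icc]; exact fun s hs => (hd2 s hs).deriv
  have hcx := convexOn_of_deriv2_nonneg (convex_Icc 0 1) hc h1 h2 fun s hs => (h3 s hs).ge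
  have hcc := concaveOn_of_deriv2_nonpos (convex_Icc 0 1) hc h1 h2 fun s hs => (h3 s hs).le
  have l0 := left_mem_Icc.2 (zero_le_one' ℝ)
  have r1 := right_mem_Icc.2 (zero_le_one' ℝ)
  have a1 := hcx.2 l0 r1 (sub_nonneg.2 ht.2) ht.1 (by ring)
  have a2 := hcc.2 l0 r1 (sub_nonneg.2 ht.2) ht.1 (by ring)
  simp only [smul_eq_mul, mul_zero, mul_one, zero_add] at a1 a2
  exact le_antisymm a1 a2

lemma ConcaveOn.mul_le_of_nonneg {x : ℝ → ℝ} (hx : ConcaveOn ℝ (Icc 0 1) x)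
    (hnn : ∀ t ∈ Icc (0 : ℝ) 1, 0 ≤ x t) {θ t s : ℝ} (hθ : 0 < θ)
    (ht : t ∈ Icc θ (1 - θ)) (hs : s ∈ Icc (0 : ℝ) 1) : θ * x s ≤ x t := by
  have hxs := hnn s hs
  have l0 := left_mem_Icc.2 (zero_le_one' ℝ)
  have r1 := right_mem_Icc.2 (zero_le_one' ℝ)
  obtain ⟨ht1, ht2⟩ := ht
  have main : ∀ e ∈ Icc (0 : ℝ) 1, ∀ r, θ ≤ r → r ≤ 1 → (1 - r) * e + r * s = t →
      θ * x s ≤ x t := by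
    intro e he r hr hr1 hrt
    have h := hx.2 he hs (sub_nonneg.2 hr1) (hθ.le.trans hr) (by ring)
    simp only [smul_eq_mul, hrt] at h
    nlinarith [mul_nonneg (sub_nonneg.2 hr1) (hnn e he), mul_nonneg (sub_nonneg.2 hr) hxs]
  rcases le_total t s with h | h
  · have hs0 : 0 < s := by linarith
    refine main 0 l0 (t / s) ?_ ((div_le_one hs0).2 h) (by field_simp; ring)
    rw [le_div_iff₀ hs0]
    nlinarith [hs.2]
  · have hs1 : 0 < 1 - s := by linarith
    refine main 1 r1 ((1 - t) / (1 - s)) ?_ ((div_le_one hs1).2 (by linarith))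
      (by field_simp; ring)
    rw [le_div_iff₀ hs1]
    nlinarith [hs.1]

theorem stmt10 (α η lam θ : ℝ) (hα : α ∈ Set.Ioc (1 : ℝ) 2) (hη : η ∈ Set.Ioc (0 : ℝ) 1)
    (hlam0 : 0 ≤ lam) (hlam : lam < 2 / η ^ 2) (hθ : θ ∈ Set.Ioo (0 : ℝ) (1 / 2))
    (f : ℝ → ℝ → ℝ)
    (hf : ContinuousOn (fun p : ℝ × ℝ => f p.1 p.2) (Set.Icc 0 1 ×ˢ Set.Ici 0))
    (hfnn : ∀ t ∈ Set.Icc (0 : ℝ) 1, ∀ u, 0 ≤ u → 0 ≤ f t u)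
    (x : ℝ → ℝ) (hxc : ContinuousOn x (Set.Icc 0 1))
    (hxnn : ∀ t ∈ Set.Icc (0 : ℝ) 1, 0 ≤ x t) :
    ((∀ t ∈ Set.Ioo (0 : ℝ) 1, DifferentiableAt ℝ x t ∧ DifferentiableAt ℝ (deriv x) t ∧
        t ^ (2 - α) * deriv (deriv x) t + f t (x t) = 0) ∧
      x 0 = 0 ∧ x 1 = lam * ∫ t in (0 : ℝ)..η, x t) ↔
    ((∀ t ∈ Set.Icc (0 : ℝ) 1, 0 ≤ x t) ∧
      (∀ t ∈ Set.Icc θ (1 - θ),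
        θ ^ 2 * sSup ((fun u => |x u|) '' Set.Icc (0 : ℝ) 1) ≤ x t) ∧
      ∀ t ∈ Set.Icc (0 : ℝ) 1, x t = ∫ s in (0 : ℝ)..1, Kf α η lam t s * f s (x s)) := by
  obtain ⟨hη0, hη1⟩ := hη
  have hηI : η ∈ Icc (0 : ℝ) 1 := ⟨hη0.le, hη1⟩
  have hD : 0 < 2 - lam * η ^ 2 := by
    rw [lt_div_iff₀ (by positivity)] at hlam
    linarith
  have hφ : ContinuousOn (fun s => f s (x s)) (Icc 0 1) :=
    hf.comp (continuousOn_id.prodMk hxc) fun s hs => ⟨hs, hxnn s hs⟩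
  set g : ℝ → ℝ := fun s => s ^ (α - 2) * f s (x s) with hgdef
  have hg : IntervalIntegrable g volume 0 1 :=
    (intervalIntegral.intervalIntegrable_rpow' (by linarith [hα.1])).mul_continuousOn
      (by rwa [uIcc_of_le zero_le_one])
  have hgc : ContinuousOn g (Ioo 0 1) :=
    (continuousOn_id.rpow_const fun s hs => Or.inl hs.1.ne').mul (hφ.mono Ioo_subset_Icc_self)
  have hode : ∀ t ∈ Ioo (0 : ℝ) 1, ∀ d, t ^ (2 - α) * d + f t (x t) = 0 ↔ d = -g t := by
    intro t ht d
    have hp : t ^ (2 - α) * t ^ (α - 2) = 1 := by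
      rw [← Real.rpow_add ht.1]; simp
    have hp0 : t ^ (2 - α) ≠ 0 := left_ne_zero_of_mul_eq_one hp
    have : t ^ (2 - α) * d + f t (x t) = t ^ (2 - α) * (d + g t) := by
      simp only [hgdef]; linear_combination (-f t (x t)) * hp
    rw [this, mul_eq_zero, or_iff_right hp0, add_eq_zero_iff_eq_neg]
  have hint : ∀ c, (∀ t ∈ Icc (0 : ℝ) 1, x t = dirichletSol g t + c * t) →
      2 * ∫ t in (0 : ℝ)..η, x t = dirichletPrim g η + c * η ^ 2 := by
    intro c hc
    have e : EqOn x (fun t => dirichletSol g t + c * t) (uIcc 0 η) := by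
      intro t ht
      rw [uIcc_of_le hη0.le] at ht
      exact hc t ⟨ht.1, ht.2.trans hη1⟩
    rw [intervalIntegral.integral_congr e, intervalIntegral.integral_add
      (((continuousOn_dirichletSol hg).mono
        (Icc_subset_Icc_right hη1)).intervalIntegrable_of_Icc hη0.le)
      (Continuous.intervalIntegrable (by fun_prop) _ _), mul_add,
      integral_dirichletSol hg hgc hηI, intervalIntegral.integral_const_mul, integral_id]
    ring
  have hK : ∀ t ∈ Icc (0 : ℝ) 1, ∫ s in (0 : ℝ)..1, Kf α η lam t s * f s (x s) =
      dirichletSol g t + lam * t / (2 - lam * η ^ 2) * dirichletPrim g η :=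
    fun t ht => integral_Kf_mul hg hηI ht
  constructor
  · rintro ⟨hx, hx0, hx1⟩
    have hx2 : ∀ t ∈ Ioo (0 : ℝ) 1, HasDerivAt (deriv x) (-g t) t := fun t ht =>
      (hx t ht).2.1.hasDerivAt.congr_deriv ((hode t ht _).1 (hx t ht).2.2)
    refine ⟨hxnn, ?_, ?_⟩
    · have hcc : ConcaveOn ℝ (Icc 0 1) x := by
        refine concaveOn_of_deriv2_nonpos (convex_Icc 0 1) hxc ?_ ?_ ?_ <;> rw [interior_Icc]
        · exact fun t ht => (hx t ht).1.differentiableWithinAt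
        · exact fun t ht => (hx t ht).2.1.differentiableWithinAt
        · intro t ht
          have htI := Ioo_subset_Icc_self ht
          have hd : deriv^[2] x t = -g t := (hx2 t ht).deriv
          rw [hd, neg_nonpos]
          exact mul_nonneg (Real.rpow_nonneg ht.1.le _) (hfnn t htI _ (hxnn t htI))
      intro t ht
      rw [mul_comm, ← le_div_iff₀ (pow_pos hθ.1 2)]
      refine csSup_le ((nonempty_Icc.2 zero_le_one).image _) ?_
      rintro _ ⟨s, hs, rfl⟩
      simp only [abs_of_nonneg (hxnn s hs)]
      rw [le_div_iff₀ (pow_pos hθ.1 2)]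
      have h := hcc.mul_le_of_nonneg hxnn hθ.1 ht hs
      have h' := mul_nonneg hθ.1.le (hxnn s hs)
      nlinarith [hθ.2]
    · have hlin : ∀ t ∈ Icc (0 : ℝ) 1, x t = dirichletSol g t + x 1 * t := by
        intro t ht
        have hy := eq_lineMap_of_deriv2_eq_zero (y := fun t => x t - dirichletSol g t)
          (hxc.sub (continuousOn_dirichletSol hg))
          (fun s hs => (hx s hs).1.sub (hasDerivAt_dirichletSol hg hgc hs).differentiableAt)
          (fun s hs => by
            refine (((hx2 s hs).fun_sub (hasDerivAt_deriv_dirichletSol hg hgc hs)).congr_deriv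
              (sub_self _)).congr_of_eventuallyEq ?_
            filter_upwards [isOpen_Ioo.mem_nhds hs] with r hr
            exact deriv_fun_sub (hx r hr).1 (hasDerivAt_dirichletSol hg hgc hr).differentiableAt)
          ht
        simp only [hx0, dirichletSol_zero, dirichletSol_one] at hy
        linarith
      have h := hint _ hlin
      intro t ht
      rw [hK t ht, hlin t ht]
      have hc : x 1 = lam / (2 - lam * η ^ 2) * dirichletPrim g η := by
        field_simp
        linear_combination 2 * hx1 + lam * h
      rw [hc]
      ring
  · rintro ⟨-, -, hx⟩
    set c := lam / (2 - lam * η ^ 2) * dirichletPrim g η with hc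
    have hlin : ∀ t ∈ Icc (0 : ℝ) 1, x t = dirichletSol g t + c * t := by
      intro t ht
      rw [hx t ht, hK t ht, hc]
      ring
    have hx1 : ∀ t ∈ Ioo (0 : ℝ) 1, HasDerivAt x (deriv (dirichletSol g) t + c) t := by
      intro t ht
      have h := (hasDerivAt_dirichletSol hg hgc ht).differentiableAt.hasDerivAt.fun_add
        ((hasDerivAt_id' t).const_mul c)
      rw [mul_one] at h
      refine h.congr_of_eventuallyEq ?_
      filter_upwards [isOpen_Ioo.mem_nhds ht] with s hs
      exact hlin s (Ioo_subset_Icc_self hs)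
    have hx2 : ∀ t ∈ Ioo (0 : ℝ) 1, HasDerivAt (deriv x) (-g t) t := by
      intro t ht
      refine ((hasDerivAt_deriv_dirichletSol hg hgc ht).add_const c).congr_of_eventuallyEq ?_
      filter_upwards [isOpen_Ioo.mem_nhds ht] with s hs
      exact (hx1 s hs).deriv
    refine ⟨fun t ht => ⟨(hx1 t ht).differentiableAt, (hx2 t ht).differentiableAt,
      (hode t ht _).2 (hx2 t ht).deriv⟩, ?_, ?_⟩
    · simpa using hlin 0 (left_mem_Icc.2 zero_le_one)
    · have h := hint c hlin
      have hx1 : x 1 = c := by simpa using hlin 1 (right_mem_Icc.2 zero_le_one)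
      have hc' : c * (2 - lam * η ^ 2) = lam * dirichletPrim g η := by
        rw [hc]; field_simp
      rw [hx1]
      linear_combination (1 / 2) * hc' - lam / 2 * h
end

section
/- Let α ∈ (1,2], η ∈ (0,1], 0 ≤ λ < 2/η², let θ ∈ (0, 1/2) be fixed, and let f : [0,1] × [0,∞) → [0,∞) be continuous. Suppose the limit f₀ = lim_{x→0⁺} min_{t∈[0,1]} f(t,x)/x exists in [0,∞] and satisfies f₀ > Λ₁, and the limit f^∞ = lim_{x→+∞} max_{t∈[0,1]} f(t,x)/x exists in [0,∞] and satisfies f^∞ < Λ₂/2. Then there exists a continuous function x : [0,1] → ℝ with x(t) ≥ 0 for all t ∈ [0,1], x not identically zero, x twice differentiable on (0,1), satisfying t^(2-α)·x''(t) + f(t, x(t)) = 0 for all t ∈ (0,1), x(0) = 0, and x(1) = λ·∫₀^η x(t) dt. -/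
open Set MeasureTheory

section Auxiliary

open Filter Topology

/-- Weighted integral `∫₀¹ s^(α-2) c(s) ds`. -/
noncomputable def wInt (α : ℝ) (c : ℝ → ℝ) : ℝ := ∫ s in (0 : ℝ)..1, s ^ (α - 2) * c s

section WeightedIntegral

variable {α : ℝ}

lemma intervalIntegrable_weight_mul (hα : 1 < α) {c : ℝ → ℝ} (hc : Continuous c) (a b : ℝ) :
    IntervalIntegrable (fun s => s ^ (α - 2) * c s) volume a b :=
  (intervalIntegral.intervalIntegrable_rpow' (by linarith)).mul_continuousOn hc.continuousOn

lemma wInt_add (hα : 1 < α) {c d : ℝ → ℝ} (hc : Continuous c) (hd : Continuous d) :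
    wInt α (fun s => c s + d s) = wInt α c + wInt α d := by
  unfold wInt
  rw [← intervalIntegral.integral_add (intervalIntegrable_weight_mul hα hc _ _)
    (intervalIntegrable_weight_mul hα hd _ _)]
  simp only [mul_add]

lemma wInt_const_mul (k : ℝ) (c : ℝ → ℝ) : wInt α (fun s => k * c s) = k * wInt α c := by
  unfold wInt
  rw [← intervalIntegral.integral_const_mul]
  congr 1
  ext s
  ring

lemma wInt_sub (hα : 1 < α) {c d : ℝ → ℝ} (hc : Continuous c) (hd : Continuous d) :
    wInt α (fun s => c s - d s) = wInt α c - wInt α d := by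
  unfold wInt
  rw [← intervalIntegral.integral_sub (intervalIntegrable_weight_mul hα hc _ _)
    (intervalIntegrable_weight_mul hα hd _ _)]
  simp only [mul_sub]

lemma wInt_mono (hα : 1 < α) {c d : ℝ → ℝ} (hc : Continuous c) (hd : Continuous d)
    (h : ∀ s ∈ Icc (0 : ℝ) 1, c s ≤ d s) : wInt α c ≤ wInt α d := by
  refine intervalIntegral.integral_mono_on zero_le_one (intervalIntegrable_weight_mul hα hc _ _)
    (intervalIntegrable_weight_mul hα hd _ _) fun s hs => ?_
  exact mul_le_mul_of_nonneg_left (h s hs) (Real.rpow_nonneg hs.1 _)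

lemma wInt_nonneg {c : ℝ → ℝ} (h : ∀ s ∈ Icc (0 : ℝ) 1, 0 ≤ c s) : 0 ≤ wInt α c :=
  intervalIntegral.integral_nonneg zero_le_one fun s hs =>
    mul_nonneg (Real.rpow_nonneg hs.1 _) (h s hs)

lemma wInt_congr {c d : ℝ → ℝ} (h : ∀ s ∈ Icc (0 : ℝ) 1, c s = d s) : wInt α c = wInt α d := by
  refine intervalIntegral.integral_congr fun s hs => ?_
  rw [uIcc_of_le zero_le_one] at hs
  simp only [h s hs]

lemma wInt_congr_Ioo {c d : ℝ → ℝ} (h : ∀ s ∈ Ioo (0 : ℝ) 1, c s = d s) :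
    wInt α c = wInt α d := by
  unfold wInt
  refine intervalIntegral.integral_congr_ae ?_
  have h1 : ∀ᵐ s : ℝ, s ≠ 1 := by simp [ae_iff]
  filter_upwards [h1] with s hs1 hs
  rw [uIoc_of_le zero_le_one] at hs
  rw [h s ⟨hs.1, lt_of_le_of_ne hs.2 hs1⟩]

/-- A weighted integral of a nonnegative continuous function vanishes only if the function
vanishes on `(0,1)`. -/
lemma eq_zero_of_wInt_eq_zero (hα : 1 < α) {c : ℝ → ℝ} (hc : Continuous c)
    (h : ∀ s ∈ Icc (0 : ℝ) 1, 0 ≤ c s) (h0 : wInt α c = 0) :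
    ∀ s ∈ Ioo (0 : ℝ) 1, c s = 0 := by
  intro s hs
  by_contra hne
  have hpos : 0 < c s := lt_of_le_of_ne (h s (Ioo_subset_Icc_self hs)) (Ne.symm hne)
  have hev : ∀ᶠ r in 𝓝 s, 0 < c r ∧ r ∈ Ioo (0 : ℝ) 1 :=
    (hc.continuousAt.eventually (lt_mem_nhds hpos)).and (isOpen_Ioo.mem_nhds hs)
  obtain ⟨ε, hε, hball⟩ := Metric.eventually_nhds_iff.1 hev
  have hsub : ∀ r ∈ Ioo (s - ε) (s + ε), 0 < c r ∧ r ∈ Ioo (0 : ℝ) 1 := fun r hr =>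
    hball (by rw [Real.dist_eq, abs_lt]; constructor <;> linarith [hr.1, hr.2])
  have h1 : 0 < ∫ r in (s - ε / 2)..(s + ε / 2), r ^ (α - 2) * c r := by
    refine intervalIntegral.intervalIntegral_pos_of_pos_on
      (intervalIntegrable_weight_mul hα hc _ _) (fun r hr => ?_) (by linarith)
    obtain ⟨hr1, hr2⟩ := hsub r ⟨by linarith [hr.1], by linarith [hr.2]⟩
    exact mul_pos (Real.rpow_pos_of_pos hr2.1 _) hr1
  have h2 : ∫ r in (s - ε / 2)..(s + ε / 2), r ^ (α - 2) * c r ≤ wInt α c := by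
    refine intervalIntegral.integral_mono_interval
      (hsub (s - ε / 2) ⟨by linarith, by linarith⟩).2.1.le (by linarith)
      (hsub (s + ε / 2) ⟨by linarith, by linarith⟩).2.2.le ?_
      (intervalIntegrable_weight_mul hα hc _ _)
    refine (ae_restrict_mem measurableSet_Ioc).mono fun r hr => ?_
    exact mul_nonneg (Real.rpow_nonneg hr.1.le _) (h r (Ioc_subset_Icc_self hr))
  linarith

lemma tendsto_wInt (hα : 1 < α) {ι : Type*} {l : Filter ι} [l.IsCountablyGenerated]
    {c : ι → ℝ → ℝ} {d : ℝ → ℝ} {B : ℝ}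
    (hc : ∀ i, Continuous (c i)) (hB : ∀ᶠ i in l, ∀ s ∈ Icc (0 : ℝ) 1, |c i s| ≤ B)
    (hlim : ∀ s ∈ Ioc (0 : ℝ) 1, Tendsto (fun i => c i s) l (𝓝 (d s))) :
    Tendsto (fun i => wInt α (c i)) l (𝓝 (wInt α d)) := by
  refine intervalIntegral.tendsto_integral_filter_of_dominated_convergence
    (fun s => s ^ (α - 2) * B) ?_ ?_ (intervalIntegrable_weight_mul hα continuous_const _ _) ?_
  · refine Eventually.of_forall fun i => ?_
    rw [uIoc_of_le zero_le_one]
    exact (intervalIntegrable_weight_mul hα (hc i) 0 1).1.aestronglyMeasurable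
  · filter_upwards [hB] with i hi
    refine Eventually.of_forall fun s hs => ?_
    rw [uIoc_of_le zero_le_one] at hs
    rw [Real.norm_eq_abs, abs_mul, abs_of_nonneg (Real.rpow_nonneg hs.1.le _)]
    exact mul_le_mul_of_nonneg_left (hi s (Ioc_subset_Icc_self hs)) (Real.rpow_nonneg hs.1.le _)
  · refine Eventually.of_forall fun s hs => ?_
    rw [uIoc_of_le zero_le_one] at hs
    exact (hlim s hs).const_mul _

lemma continuous_wInt (hα : 1 < α) {P : Type*} [TopologicalSpace P] [FirstCountableTopology P]
    [WeaklyLocallyCompactSpace P] {c : P → ℝ → ℝ} (hc : Continuous fun q : P × ℝ => c q.1 q.2) :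
    Continuous fun p => wInt α (c p) := by
  refine continuous_iff_continuousAt.2 fun p => ?_
  obtain ⟨K, hK, hpK⟩ := exists_compact_mem_nhds p
  obtain ⟨B, hB⟩ := (hK.prod (isCompact_Icc (a := (0 : ℝ)) (b := 1))).exists_bound_of_continuousOn
    hc.continuousOn
  refine tendsto_wInt hα (B := B) (fun q => by fun_prop) ?_ fun s _ => ?_
  · filter_upwards [hpK] with q hq s hs
    exact hB (q, s) ⟨hq, hs⟩
  · exact (by fun_prop : Continuous fun q => c q s).tendsto p

end WeightedIntegral

section Kernel

variable {α η : ℝ}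

/-- The kernel `H(η,s)` without its weight `s^(α-2)`. -/
def hKer (η s : ℝ) : ℝ := η ^ 2 * (1 - s) - max (η - s) 0 ^ 2

lemma continuous_hKer (η : ℝ) : Continuous (hKer η) := by
  unfold hKer
  fun_prop

lemma hKer_nonneg (hη : η ∈ Ioc (0 : ℝ) 1) {s : ℝ} (hs : s ∈ Icc (0 : ℝ) 1) : 0 ≤ hKer η s := by
  obtain ⟨h0, h1⟩ := hη
  obtain ⟨hs0, hs1⟩ := hs
  unfold hKer
  rcases le_total s η with h | h
  · rw [max_eq_left (by linarith)]
    have : 0 ≤ s * ((η - s) + η * (1 - η)) :=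
      mul_nonneg hs0 (add_nonneg (by linarith) (mul_nonneg h0.le (by linarith)))
    nlinarith
  · rw [max_eq_right (by linarith)]
    have : 0 ≤ η ^ 2 * (1 - s) := mul_nonneg (sq_nonneg _) (by linarith)
    nlinarith

lemma hKer_le (hη : η ∈ Ioc (0 : ℝ) 1) {s : ℝ} (hs : s ∈ Icc (0 : ℝ) 1) :
    hKer η s ≤ s * (1 - s) := by
  obtain ⟨h0, h1⟩ := hη
  obtain ⟨hs0, hs1⟩ := hs
  unfold hKer
  rcases le_total s η with h | h
  · rw [max_eq_left (by linarith)]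
    have : 0 ≤ s * (1 - η) ^ 2 := mul_nonneg hs0 (sq_nonneg _)
    nlinarith
  · rw [max_eq_right (by linarith)]
    have h2 : η ^ 2 ≤ s := by nlinarith
    have : η ^ 2 * (1 - s) ≤ s * (1 - s) := mul_le_mul_of_nonneg_right h2 (by linarith)
    nlinarith

lemma Hf_eq_weight_mul_hKer {s : ℝ} (hs : 0 < s) : Hf α η s = s ^ (α - 2) * hKer η s := by
  have h1 : s ^ (α - 1) = s ^ (α - 2) * s := by
    rw [show α - 1 = (α - 2) + 1 by ring, Real.rpow_add hs, Real.rpow_one]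
  unfold Hf hKer
  split_ifs with h
  · rw [max_eq_left (by linarith), h1]
    ring
  · rw [max_eq_right (by linarith)]
    ring

lemma green_bounds {t s : ℝ} (ht : t ∈ Icc (0 : ℝ) 1) (hs : s ∈ Icc (0 : ℝ) 1) :
    t * (1 - t) * (s * (1 - s)) ≤ t * (1 - s) - max (t - s) 0 ∧
      t * (1 - s) - max (t - s) 0 ≤ s * (1 - s) := by
  obtain ⟨ht0, ht1⟩ := ht
  obtain ⟨hs0, hs1⟩ := hs
  rcases le_total s t with h | h
  · rw [max_eq_left (by linarith)]
    have h1 : 0 ≤ s * (1 - t) * (1 - t * (1 - s)) :=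
      mul_nonneg (mul_nonneg hs0 (by linarith)) (by nlinarith)
    have h2 : 0 ≤ s * (t - s) := mul_nonneg hs0 (by linarith)
    constructor <;> nlinarith
  · rw [max_eq_right (by linarith)]
    have h1 : 0 ≤ t * (1 - s) * (1 - s * (1 - t)) :=
      mul_nonneg (mul_nonneg ht0 (by linarith)) (by nlinarith)
    have h2 : 0 ≤ (s - t) * (1 - s) := mul_nonneg (by linarith) (by linarith)
    constructor <;> nlinarith

variable {y : ℝ → ℝ}

lemma green_wInt_bounds (hα : 1 < α) (hy : Continuous y) (hy0 : ∀ s, 0 ≤ y s) {t : ℝ}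
    (ht : t ∈ Icc (0 : ℝ) 1) :
    t * (1 - t) * wInt α (fun s => s * (1 - s) * y s) ≤
        t * wInt α (fun s => (1 - s) * y s) - wInt α (fun s => max (t - s) 0 * y s) ∧
      t * wInt α (fun s => (1 - s) * y s) - wInt α (fun s => max (t - s) 0 * y s) ≤
        wInt α (fun s => s * (1 - s) * y s) := by
  rw [← wInt_const_mul, ← wInt_const_mul, ← wInt_sub hα (by fun_prop) (by fun_prop)]
  constructor
  · refine wInt_mono hα (by fun_prop) (by fun_prop) fun s hs => ?_
    nlinarith [mul_le_mul_of_nonneg_right (green_bounds ht hs).1 (hy0 s)]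
  · refine wInt_mono hα (by fun_prop) (by fun_prop) fun s hs => ?_
    nlinarith [mul_le_mul_of_nonneg_right (green_bounds ht hs).2 (hy0 s)]

lemma hKer_wInt_nonneg (hη : η ∈ Ioc (0 : ℝ) 1) (hy0 : ∀ s, 0 ≤ y s) :
    0 ≤ wInt α (fun s => hKer η s * y s) :=
  wInt_nonneg fun s hs => mul_nonneg (hKer_nonneg hη hs) (hy0 s)

lemma kernel_wInt_eq (hα : 1 < α) (hy : Continuous y) (μ : ℝ) :
    wInt α (fun s => (s * (1 - s) + μ * hKer η s) * y s) =
      wInt α (fun s => s * (1 - s) * y s) + μ * wInt α (fun s => hKer η s * y s) := by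
  have := continuous_hKer η
  rw [← wInt_const_mul, ← wInt_add hα (by fun_prop) (by fun_prop)]
  exact wInt_congr fun s _ => by ring

end Kernel

section Shooting

variable {α η μ m h : ℝ} {g : ℝ → ℝ → ℝ} {x : ℝ → ℝ}

/-- For small positive initial slope, a solution of the retarded problem misses the nonlocal
boundary condition from below. -/
lemma slope_lt_of_small (hα : 1 < α) (hη : η ∈ Ioc (0 : ℝ) 1) (hμ : 0 ≤ μ)
    (hg : Continuous fun p : ℝ × ℝ => g p.1 p.2) (hg0 : ∀ s u, 0 ≤ g s u)
    {θ δ Λ : ℝ} (hθ : θ ∈ Ioo (0 : ℝ) (1 / 2)) (hΛ : 0 ≤ Λ)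
    (hgΛ : ∀ s ∈ Icc (0 : ℝ) 1, ∀ u, 0 ≤ u → u ≤ δ → Λ * u ≤ g s u)
    (hJ : 1 < Λ * θ ^ 2 * ∫ s in θ..(1 - θ), s ^ (α - 2) * (s * (1 - s) + μ * hKer η s))
    (hh : 0 < h) (hhθ : h < θ) (hθh : θ ^ 2 ≤ (θ - h) * (1 - (θ - h)))
    (hx : Continuous x) (hm : 0 < m) (hmδ : m ≤ δ)
    (hxeq : ∀ t ≤ 1, x t = m * t - wInt α (fun s => max (t - s) 0 * g s (x (s - h)))) :
    m < wInt α (fun s => (1 - s) * g s (x (s - h))) +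
      μ * wInt α (fun s => hKer η s * g s (x (s - h))) := by
  by_contra! hE
  set y : ℝ → ℝ := fun s => g s (x (s - h)) with hydef
  have hyc : Continuous y := by fun_prop
  have hy0 : ∀ s, 0 ≤ y s := fun s => hg0 _ _
  have hkc := continuous_hKer η
  set a := wInt α (fun s => (1 - s) * y s) with ha
  set b := wInt α (fun s => hKer η s * y s) with hb
  set q := wInt α (fun s => s * (1 - s) * y s) with hq
  have hb0 : 0 ≤ b := hKer_wInt_nonneg hη hy0
  have hμb : 0 ≤ μ * b := mul_nonneg hμ hb0
  have hq0 : 0 ≤ q := wInt_nonneg fun s hs =>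
    mul_nonneg (mul_nonneg hs.1 (by linarith [hs.2])) (hy0 s)
  have hE0 : 0 ≤ m - a - μ * b := by linarith
  set S := q + μ * b + (m - a - μ * b) with hS
  have hS0 : 0 ≤ S := by linarith
  have hlow : ∀ t ∈ Icc (0 : ℝ) 1, t * (1 - t) * S ≤ x t := by
    intro t ht
    have h1 := (green_wInt_bounds hα hyc hy0 ht).1
    rw [hxeq t ht.2]
    have h2 : 0 ≤ t ^ 2 * (m - a) := mul_nonneg (sq_nonneg t) (by linarith)
    nlinarith
  have hupp : ∀ t ∈ Icc (0 : ℝ) 1, x t ≤ S := by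
    intro t ht
    have h1 := (green_wInt_bounds hα hyc hy0 ht).2
    rw [hxeq t ht.2]
    have h2 : 0 ≤ (1 - t) * (m - a) := mul_nonneg (by linarith [ht.2]) (by linarith)
    nlinarith
  have hxm : ∀ t ∈ Icc (0 : ℝ) 1, x t ≤ δ := by
    intro t ht
    rw [hxeq t ht.2]
    have h1 : 0 ≤ wInt α (fun s => max (t - s) 0 * y s) :=
      wInt_nonneg fun s _ => mul_nonneg (le_max_right _ _) (hy0 s)
    have h2 : m * t ≤ m := mul_le_of_le_one_right hm.le ht.2
    linarith
  have hyl : ∀ s ∈ Icc θ (1 - θ), Λ * θ ^ 2 * S ≤ y s := by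
    intro s hs
    have hs' : s - h ∈ Icc (0 : ℝ) 1 := ⟨by linarith [hs.1], by linarith [hs.2, hθ.1]⟩
    have h1 : 0 ≤ (s - h - (θ - h)) * (1 - (θ - h) - (s - h)) :=
      mul_nonneg (by linarith [hs.1]) (by linarith [hs.2])
    have h2 : θ ^ 2 ≤ (s - h) * (1 - (s - h)) := by nlinarith
    have h3 : θ ^ 2 * S ≤ x (s - h) :=
      (mul_le_mul_of_nonneg_right h2 hS0).trans (hlow _ hs')
    have h4 : 0 ≤ x (s - h) := (mul_nonneg (sq_nonneg θ) hS0).trans h3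
    have h5 : Λ * x (s - h) ≤ y s :=
      hgΛ s ⟨by linarith [hs.1, hθ.1], by linarith [hs.2, hθ.1]⟩ _ h4 (hxm _ hs')
    nlinarith [mul_le_mul_of_nonneg_left h3 hΛ]
  set J := ∫ s in θ..(1 - θ), s ^ (α - 2) * (s * (1 - s) + μ * hKer η s) with hJdef
  have hφ0 : ∀ s ∈ Icc (0 : ℝ) 1, 0 ≤ s * (1 - s) + μ * hKer η s := fun s hs =>
    add_nonneg (mul_nonneg hs.1 (by linarith [hs.2])) (mul_nonneg hμ (hKer_nonneg hη hs))
  have hθθ : θ ≤ 1 - θ := by linarith [hθ.2]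
  have hkey : Λ * θ ^ 2 * S * J ≤ q + μ * b := by
    rw [← kernel_wInt_eq hα hyc μ]
    refine le_trans ?_ (intervalIntegral.integral_mono_interval hθ.1.le hθθ
      (by linarith [hθ.1]) ?_ (intervalIntegrable_weight_mul hα (by fun_prop) 0 1))
    · rw [hJdef, ← intervalIntegral.integral_const_mul]
      refine intervalIntegral.integral_mono_on hθθ
        ((intervalIntegrable_weight_mul hα (by fun_prop) _ _).const_mul _)
        (intervalIntegrable_weight_mul hα (by fun_prop) _ _) fun s hs => ?_
      have hs' : s ∈ Icc (0 : ℝ) 1 := ⟨by linarith [hs.1, hθ.1], by linarith [hs.2, hθ.1]⟩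
      have := mul_le_mul_of_nonneg_left (hyl s hs)
        (mul_nonneg (Real.rpow_nonneg hs'.1 (α - 2)) (hφ0 s hs'))
      linarith
    · refine (ae_restrict_mem measurableSet_Ioc).mono fun s hs => ?_
      exact mul_nonneg (Real.rpow_nonneg hs.1.le _)
        (mul_nonneg (hφ0 s (Ioc_subset_Icc_self hs)) (hy0 s))
  have hSz : S = 0 := by
    by_contra hne
    have : 0 < S := lt_of_le_of_ne hS0 (Ne.symm hne)
    nlinarith [mul_lt_mul_of_pos_left hJ this]
  have hqz : q = 0 := by linarith
  have hyz : ∀ s ∈ Ioo (0 : ℝ) 1, y s = 0 := by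
    intro s hs
    have := eq_zero_of_wInt_eq_zero hα (by fun_prop)
      (fun s hs => mul_nonneg (mul_nonneg hs.1 (by linarith [hs.2])) (hy0 s)) hqz s hs
    have h1 : s * (1 - s) ≠ 0 := (mul_pos hs.1 (by linarith [hs.2])).ne'
    exact (mul_eq_zero.1 this).resolve_left h1
  have haz : a = 0 := by
    rw [ha, wInt_congr_Ioo (d := fun s => 0 * y s) fun s hs => by simp [hyz s hs],
      wInt_const_mul, zero_mul]
  linarith

/-- A bound on the nonlinearity along a solution of the retarded problem whose slope does not
exceed the one prescribed by the nonlocal boundary condition. -/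
lemma nonlinearity_le (hα : 1 < α) (hη : η ∈ Ioc (0 : ℝ) 1) (hμ : 0 ≤ μ)
    (hg : Continuous fun p : ℝ × ℝ => g p.1 p.2) (hg0 : ∀ s u, 0 ≤ g s u)
    {c C : ℝ} (hc : 0 ≤ c)
    (hgc : ∀ s ∈ Icc (0 : ℝ) 1, ∀ u, g s u ≤ c * max u 0 + C)
    (hI : c * wInt α (fun s => s * (1 - s) + μ * hKer η s) ≤ 1 / 2)
    (hh : 0 < h) (hx : Continuous x) (hm : 0 ≤ m)
    (hxeq : ∀ t ≤ 1, x t = m * t - wInt α (fun s => max (t - s) 0 * g s (x (s - h))))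
    (hE : m ≤ wInt α (fun s => (1 - s) * g s (x (s - h))) +
      μ * wInt α (fun s => hKer η s * g s (x (s - h)))) :
    ∀ s ∈ Icc (0 : ℝ) 1, g s (x (s - h)) ≤
      2 * c * C * wInt α (fun s => s * (1 - s) + μ * hKer η s) + C := by
  set y : ℝ → ℝ := fun s => g s (x (s - h)) with hydef
  have hyc : Continuous y := by fun_prop
  have hy0 : ∀ s, 0 ≤ y s := fun s => hg0 _ _
  have hkc := continuous_hKer η
  set a := wInt α (fun s => (1 - s) * y s) with ha
  set b := wInt α (fun s => hKer η s * y s) with hb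
  set q := wInt α (fun s => s * (1 - s) * y s) with hq
  set I := wInt α (fun s => s * (1 - s) + μ * hKer η s) with hIdef
  have hb0 : 0 ≤ b := hKer_wInt_nonneg hη hy0
  have hμb : 0 ≤ μ * b := mul_nonneg hμ hb0
  have hq0 : 0 ≤ q := wInt_nonneg fun s hs =>
    mul_nonneg (mul_nonneg hs.1 (by linarith [hs.2])) (hy0 s)
  have hφ0 : ∀ s ∈ Icc (0 : ℝ) 1, 0 ≤ s * (1 - s) + μ * hKer η s := fun s hs =>
    add_nonneg (mul_nonneg hs.1 (by linarith [hs.2])) (mul_nonneg hμ (hKer_nonneg hη hs))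
  set S := q + μ * b with hS
  have hS0 : 0 ≤ S := by linarith
  have hupp : ∀ t ≤ 1, x t ≤ S := by
    intro t ht1
    rcases le_total 0 t with ht0 | ht0
    · have h1 := (green_wInt_bounds hα hyc hy0 ⟨ht0, ht1⟩).2
      rw [hxeq t ht1]
      have h2 : t * m ≤ t * (a + μ * b) := mul_le_mul_of_nonneg_left hE ht0
      have h3 : t * (μ * b) ≤ μ * b := mul_le_of_le_one_left hμb ht1
      linarith
    · rw [hxeq t ht1]
      have h1 : 0 ≤ wInt α (fun s => max (t - s) 0 * y s) :=
        wInt_nonneg fun s _ => mul_nonneg (le_max_right _ _) (hy0 s)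
      have h2 : m * t ≤ 0 := mul_nonpos_of_nonneg_of_nonpos hm ht0
      linarith
  have hyS : ∀ s ∈ Icc (0 : ℝ) 1, y s ≤ c * S + C := by
    intro s hs
    have h1 : max (x (s - h)) 0 ≤ S := max_le (hupp _ (by linarith [hs.2])) hS0
    have h2 : y s ≤ c * max (x (s - h)) 0 + C := hgc s hs _
    linarith [mul_le_mul_of_nonneg_left h1 hc]
  have hSI : S ≤ (c * S + C) * I := by
    rw [hS, ← kernel_wInt_eq hα hyc μ, hIdef, ← wInt_const_mul]
    refine wInt_mono hα (by fun_prop) (by fun_prop) fun s hs => ?_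
    rw [kernel_wInt_eq hα hyc μ]
    linarith [mul_le_mul_of_nonneg_left (hyS s hs) (hφ0 s hs)]
  have hS2 : S ≤ 2 * C * I := by
    nlinarith [mul_le_mul_of_nonneg_left hI hS0]
  intro s hs
  refine (hyS s hs).trans ?_
  nlinarith [mul_le_mul_of_nonneg_left hS2 hc]

/-- If `y ≤ B` on `[0,1]`, the slope prescribed by the nonlocal boundary condition is bounded. -/
lemma prescribed_slope_le (hα : 1 < α) (hη : η ∈ Ioc (0 : ℝ) 1) (hμ : 0 ≤ μ) {y : ℝ → ℝ} {B : ℝ}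
    (hy : Continuous y) (hyB : ∀ s ∈ Icc (0 : ℝ) 1, y s ≤ B) :
    wInt α (fun s => (1 - s) * y s) + μ * wInt α (fun s => hKer η s * y s) ≤
      B * (wInt α (fun s => 1 - s) + μ * wInt α (hKer η)) := by
  have hkc := continuous_hKer η
  have h1 : wInt α (fun s => (1 - s) * y s) ≤ B * wInt α (fun s => 1 - s) := by
    rw [← wInt_const_mul]
    refine wInt_mono hα (by fun_prop) (by fun_prop) fun s hs => ?_
    linarith [mul_le_mul_of_nonneg_left (hyB s hs) (sub_nonneg.2 hs.2)]
  have h2 : wInt α (fun s => hKer η s * y s) ≤ B * wInt α (hKer η) := by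
    rw [← wInt_const_mul]
    refine wInt_mono hα (by fun_prop) (by fun_prop) fun s hs => ?_
    linarith [mul_le_mul_of_nonneg_left (hyB s hs) (hKer_nonneg hη hs)]
  linarith [mul_le_mul_of_nonneg_left h2 hμ]

/-- Picard iterates for the problem with retardation `h` and initial slope `m`. -/
noncomputable def retardedIter (α h : ℝ) (g : ℝ → ℝ → ℝ) : ℕ → ℝ → ℝ → ℝ
  | 0, m, t => m * t
  | k + 1, m, t =>
    m * t - wInt α (fun s => max (t - s) 0 * g s (retardedIter α h g k m (s - h)))

lemma continuous_retardedIter (hα : 1 < α) (h : ℝ)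
    (hg : Continuous fun p : ℝ × ℝ => g p.1 p.2) (k : ℕ) :
    Continuous fun p : ℝ × ℝ => retardedIter α h g k p.1 p.2 := by
  induction k with
  | zero => simp only [retardedIter]; fun_prop
  | succ k ih =>
    simp only [retardedIter]
    refine Continuous.sub (by fun_prop) ?_
    refine continuous_wInt hα (P := ℝ × ℝ)
      (c := fun p s => max (p.2 - s) 0 * g s (retardedIter α h g k p.1 (s - h))) ?_
    have h1 : Continuous fun q : (ℝ × ℝ) × ℝ => retardedIter α h g k q.1.1 (q.2 - h) :=
      ih.comp (by fun_prop : Continuous fun q : (ℝ × ℝ) × ℝ => (q.1.1, q.2 - h))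
    have h2 : Continuous fun q : (ℝ × ℝ) × ℝ =>
        g q.2 (retardedIter α h g k q.1.1 (q.2 - h)) :=
      hg.comp (continuous_snd.prodMk h1)
    fun_prop

lemma retardedIter_stable (m : ℝ) (k : ℕ) :
    ∀ t ≤ k * h, retardedIter α h g (k + 1) m t = retardedIter α h g k m t := by
  induction k with
  | zero =>
    intro t ht
    have ht' : t ≤ 0 := by simpa using ht
    simp only [retardedIter]
    rw [wInt_congr (d := fun s => 0 * s), wInt_const_mul]
    · ring
    · intro s hs
      rw [max_eq_right (by linarith [hs.1])]
      ring
  | succ k ih =>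
    intro t ht
    rw [retardedIter, retardedIter]
    congr 1
    refine wInt_congr fun s _ => ?_
    rcases le_total t s with hst | hst
    · rw [max_eq_right (by linarith)]
      ring
    · rw [ih (s - h) (by push_cast at ht; linarith)]

lemma exists_retarded_solution (hα : 1 < α) (hη : η ∈ Ioc (0 : ℝ) 1) (hμ : 0 ≤ μ)
    (hg : Continuous fun p : ℝ × ℝ => g p.1 p.2) (hg0 : ∀ s u, 0 ≤ g s u)
    {θ δ Λ : ℝ} (hθ : θ ∈ Ioo (0 : ℝ) (1 / 2)) (hδ : 0 < δ) (hΛ : 0 ≤ Λ)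
    (hgΛ : ∀ s ∈ Icc (0 : ℝ) 1, ∀ u, 0 ≤ u → u ≤ δ → Λ * u ≤ g s u)
    (hJ : 1 < Λ * θ ^ 2 * ∫ s in θ..(1 - θ), s ^ (α - 2) * (s * (1 - s) + μ * hKer η s))
    {c C : ℝ} (hc : 0 ≤ c)
    (hgc : ∀ s ∈ Icc (0 : ℝ) 1, ∀ u, g s u ≤ c * max u 0 + C)
    (hI : c * wInt α (fun s => s * (1 - s) + μ * hKer η s) ≤ 1 / 2)
    (hh : 0 < h) (hhθ : h < θ) (hθh : θ ^ 2 ≤ (θ - h) * (1 - (θ - h))) :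
    ∃ m, δ ≤ m ∧ ∃ x, Continuous x ∧
      (∀ t ≤ 1, x t = m * t - wInt α (fun s => max (t - s) 0 * g s (x (s - h)))) ∧
      m = wInt α (fun s => (1 - s) * g s (x (s - h))) +
        μ * wInt α (fun s => hKer η s * g s (x (s - h))) := by
  obtain ⟨N, hN⟩ := exists_nat_ge (1 / h)
  have hN1 : 1 ≤ N * h := by rwa [div_le_iff₀ hh] at hN
  set X := retardedIter α h g N with hX
  have hXc : Continuous fun p : ℝ × ℝ => X p.1 p.2 := continuous_retardedIter hα h hg N
  have hXm : ∀ m, Continuous (X m) := fun m => by fun_prop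
  have hXeq : ∀ m, ∀ t ≤ 1,
      X m t = m * t - wInt α (fun s => max (t - s) 0 * g s (X m (s - h))) := by
    intro m t ht
    rw [hX, ← retardedIter_stable m N t (ht.trans hN1), retardedIter]
  have hkc := continuous_hKer η
  set E : ℝ → ℝ := fun m => m - (wInt α (fun s => (1 - s) * g s (X m (s - h))) +
    μ * wInt α (fun s => hKer η s * g s (X m (s - h)))) with hE
  have hEc : Continuous E := by
    have h1 : Continuous fun q : ℝ × ℝ => X q.1 (q.2 - h) :=
      hXc.comp (by fun_prop : Continuous fun q : ℝ × ℝ => (q.1, q.2 - h))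
    have h2 : Continuous fun q : ℝ × ℝ => g q.2 (X q.1 (q.2 - h)) :=
      hg.comp (continuous_snd.prodMk h1)
    have h3 := continuous_wInt hα (P := ℝ) (c := fun m s => (1 - s) * g s (X m (s - h)))
      (by fun_prop)
    have h4 := continuous_wInt hα (P := ℝ) (c := fun m s => hKer η s * g s (X m (s - h)))
      (by fun_prop)
    fun_prop
  set B := 2 * c * C * wInt α (fun s => s * (1 - s) + μ * hKer η s) + C with hB
  set M := max δ (B * (wInt α (fun s => 1 - s) + μ * wInt α (hKer η)) + 1) with hM
  have hδM : δ ≤ M := le_max_left _ _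
  have hEδ : E δ ≤ 0 := by
    have := slope_lt_of_small hα hη hμ hg hg0 hθ hΛ hgΛ hJ hh hhθ hθh (hXm δ) hδ le_rfl (hXeq δ)
    simp only [hE]
    linarith
  have hEM : 0 ≤ E M := by
    by_contra! hneg
    have hle : M ≤ wInt α (fun s => (1 - s) * g s (X M (s - h))) +
        μ * wInt α (fun s => hKer η s * g s (X M (s - h))) := by
      simp only [hE] at hneg
      linarith
    have h1 := nonlinearity_le hα hη hμ hg hg0 hc hgc hI hh (hXm M) (hδ.le.trans hδM)
      (hXeq M) hle
    have hXM := hXm M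
    have h2 := prescribed_slope_le hα hη hμ (y := fun s => g s (X M (s - h))) (by fun_prop) h1
    have h3 : B * (wInt α (fun s => 1 - s) + μ * wInt α (hKer η)) + 1 ≤ M := le_max_right _ _
    linarith
  obtain ⟨m, hm, hm0⟩ := intermediate_value_Icc hδM hEc.continuousOn ⟨hEδ, hEM⟩
  exact ⟨m, hm.1, X m, hXm m, hXeq m, by simp only [hE] at hm0; linarith⟩

end Shooting

section Limit

variable {α η μ : ℝ} {g : ℝ → ℝ → ℝ}

lemma abs_sub_le_of_slope {m B : ℝ} (hα : 1 < α) (hm : 0 ≤ m) {x y : ℝ → ℝ} (hy : Continuous y)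
    (hy0 : ∀ s, 0 ≤ y s) (hyB : ∀ s ∈ Icc (0 : ℝ) 1, y s ≤ B)
    (hxeq : ∀ t ≤ 1, x t = m * t - wInt α (fun s => max (t - s) 0 * y s)) {t t' : ℝ}
    (ht : t ≤ 1) (htt' : t' ≤ t) :
    |x t - x t'| ≤ (m + B * wInt α (fun _ => 1)) * (t - t') := by
  have hW : 0 ≤ wInt α (fun _ => 1) := wInt_nonneg fun _ _ => zero_le_one
  have hB0 : 0 ≤ B := (hy0 0).trans (hyB 0 ⟨le_rfl, zero_le_one⟩)
  have hd : 0 ≤ t - t' := by linarith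
  have key : wInt α (fun s => max (t - s) 0 * y s) - wInt α (fun s => max (t' - s) 0 * y s) =
      wInt α (fun s => (max (t - s) 0 - max (t' - s) 0) * y s) := by
    rw [← wInt_sub hα (by fun_prop) (by fun_prop)]
    exact wInt_congr fun s _ => by ring
  have hmax : ∀ s, 0 ≤ max (t - s) 0 - max (t' - s) 0 ∧
      max (t - s) 0 - max (t' - s) 0 ≤ t - t' := by
    intro s
    rcases le_total (t - s) 0 with h1 | h1 <;> rcases le_total (t' - s) 0 with h2 | h2 <;>
      simp only [max_eq_left, max_eq_right, h1, h2] <;> constructor <;> linarith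
  have h1 : 0 ≤ wInt α (fun s => (max (t - s) 0 - max (t' - s) 0) * y s) :=
    wInt_nonneg fun s _ => mul_nonneg (hmax s).1 (hy0 s)
  have h2 : wInt α (fun s => (max (t - s) 0 - max (t' - s) 0) * y s) ≤
      (t - t') * B * wInt α (fun _ => 1) := by
    rw [← wInt_const_mul]
    refine wInt_mono hα (by fun_prop) (by fun_prop) fun s hs => ?_
    have := mul_le_mul (hmax s).2 (hyB s hs) (hy0 s) hd
    linarith
  rw [hxeq t ht, hxeq t' (htt'.trans ht), abs_le]
  have h3 : 0 ≤ m * (t - t') := mul_nonneg hm hd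
  have h4 : 0 ≤ (t - t') * B * wInt α (fun _ => 1) := mul_nonneg (mul_nonneg hd hB0) hW
  constructor <;> nlinarith

lemma exists_integral_solution (hα : 1 < α) (hη : η ∈ Ioc (0 : ℝ) 1) (hμ : 0 ≤ μ)
    (hg : Continuous fun p : ℝ × ℝ => g p.1 p.2) (hg0 : ∀ s u, 0 ≤ g s u)
    {θ δ Λ : ℝ} (hθ : θ ∈ Ioo (0 : ℝ) (1 / 2)) (hδ : 0 < δ) (hΛ : 0 ≤ Λ)
    (hgΛ : ∀ s ∈ Icc (0 : ℝ) 1, ∀ u, 0 ≤ u → u ≤ δ → Λ * u ≤ g s u)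
    (hJ : 1 < Λ * θ ^ 2 * ∫ s in θ..(1 - θ), s ^ (α - 2) * (s * (1 - s) + μ * hKer η s))
    {c C : ℝ} (hc : 0 ≤ c)
    (hgc : ∀ s ∈ Icc (0 : ℝ) 1, ∀ u, g s u ≤ c * max u 0 + C)
    (hI : c * wInt α (fun s => s * (1 - s) + μ * hKer η s) ≤ 1 / 2) :
    ∃ m, 0 < m ∧ ∃ x, Continuous x ∧
      (∀ t ∈ Icc (0 : ℝ) 1, x t = m * t - wInt α (fun s => max (t - s) 0 * g s (x s))) ∧
      m = wInt α (fun s => (1 - s) * g s (x s)) + μ * wInt α (fun s => hKer η s * g s (x s)) := by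
  have hev : ∀ᶠ h in 𝓝 (0 : ℝ), h < θ ∧ θ ^ 2 < (θ - h) * (1 - (θ - h)) := by
    refine (gt_mem_nhds hθ.1).and ?_
    have hcont : ContinuousAt (fun h : ℝ => (θ - h) * (1 - (θ - h))) 0 := by fun_prop
    refine hcont.eventually (lt_mem_nhds ?_)
    nlinarith [hθ.1, hθ.2]
  obtain ⟨ε, hε, hball⟩ := Metric.eventually_nhds_iff.1 hev
  set h : ℕ → ℝ := fun n => ε / (n + 2) with hh
  have hpos : ∀ n, 0 < h n := fun n => by positivity
  have hlt : ∀ n, h n < ε := fun n => by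
    have : (0 : ℝ) ≤ n := n.cast_nonneg
    exact div_lt_self hε (by linarith)
  have hlim : Tendsto h atTop (𝓝 0) :=
    tendsto_const_nhds.div_atTop
      (tendsto_atTop_add_const_right _ _ tendsto_natCast_atTop_atTop)
  have hsm : ∀ n, h n < θ ∧ θ ^ 2 < (θ - h n) * (1 - (θ - h n)) := fun n =>
    hball (by rw [Real.dist_eq, sub_zero, abs_of_pos (hpos n)]; exact hlt n)
  choose m hδm x hxc hxeq hmeq using fun n =>
    exists_retarded_solution hα hη hμ hg hg0 hθ hδ hΛ hgΛ hJ hc hgc hI (hpos n) (hsm n).1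
      (hsm n).2.le
  have hkc := continuous_hKer η
  set B := 2 * c * C * wInt α (fun s => s * (1 - s) + μ * hKer η s) + C with hB
  set M := B * (wInt α (fun s => 1 - s) + μ * wInt α (hKer η)) with hM
  have hyc : ∀ n, Continuous fun s => g s (x n (s - h n)) := fun n => by
    have := hxc n
    fun_prop
  have hyB : ∀ n, ∀ s ∈ Icc (0 : ℝ) 1, g s (x n (s - h n)) ≤ B := fun n =>
    nonlinearity_le hα hη hμ hg hg0 hc hgc hI (hpos n) (hxc n) (hδ.le.trans (hδm n)) (hxeq n)
      (hmeq n).le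
  have hmM : ∀ n, m n ≤ M := fun n => by
    rw [hmeq n]
    exact prescribed_slope_le hα hη hμ (hyc n) (hyB n)
  have hB0 : 0 ≤ B := (hg0 _ _).trans (hyB 0 0 ⟨le_rfl, zero_le_one⟩)
  set L := M + B * wInt α (fun _ => 1) with hL
  have hW : 0 ≤ wInt α (fun _ => 1) := wInt_nonneg fun _ _ => zero_le_one
  have hL0 : 0 ≤ L :=
    add_nonneg (hδ.le.trans ((hδm 0).trans (hmM 0))) (mul_nonneg hB0 hW)
  have hLip : ∀ n, ∀ t ≤ 1, ∀ t' ≤ t, |x n t - x n t'| ≤ L * (t - t') := by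
    intro n t ht t' htt'
    refine (abs_sub_le_of_slope hα (hδ.le.trans (hδm n)) (hyc n) (fun s => hg0 _ _) (hyB n)
      (hxeq n) ht htt').trans ?_
    refine mul_le_mul_of_nonneg_right ?_ (by linarith)
    linarith [hmM n]
  have hx0 : ∀ n, x n 0 = 0 := by
    intro n
    rw [hxeq n 0 zero_le_one, wInt_congr (d := fun s => 0 * s), wInt_const_mul]
    · ring
    · intro s hs
      rw [max_eq_right (by linarith [hs.1])]
      ring
  have hxL : ∀ n, ∀ t ∈ Icc (0 : ℝ) 1, |x n t| ≤ L := by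
    intro n t ht
    have h1 := hLip n t ht.2 0 ht.1
    rw [hx0, sub_zero, sub_zero] at h1
    exact h1.trans (mul_le_of_le_one_right hL0 ht.2)
  let F : ℕ → BoundedContinuousFunction (Icc (0 : ℝ) 1) ℝ := fun n =>
    BoundedContinuousFunction.mkOfCompact ⟨fun t => x n t, (hxc n).comp continuous_subtype_val⟩
  have hFcomp : IsCompact (closure (range F)) := by
    refine BoundedContinuousFunction.arzela_ascoli (Icc (-L) L) isCompact_Icc _ ?_ ?_
    · rintro _ t ⟨n, rfl⟩
      exact abs_le.1 (hxL n t t.2)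
    · refine (LipschitzWith.uniformEquicontinuous _ ⟨L, hL0⟩ ?_).equicontinuous
      rintro ⟨_, n, rfl⟩
      refine LipschitzWith.of_dist_le_mul fun t t' => ?_
      change |x n t - x n t'| ≤ L * |(t : ℝ) - t'|
      rcases le_total (t : ℝ) t' with htt | htt
      · rw [abs_sub_comm, abs_sub_comm (t : ℝ), abs_of_nonneg (sub_nonneg.2 htt)]
        exact hLip n t' t'.2.2 t htt
      · rw [abs_of_nonneg (sub_nonneg.2 htt)]
        exact hLip n t t.2.2 t' htt
  obtain ⟨⟨z, m'⟩, hzm, φ, hφ, hconv⟩ :=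
    (hFcomp.prod (isCompact_Icc (a := δ) (b := M))).tendsto_subseq
      (x := fun n => (F n, m n)) fun n => ⟨subset_closure ⟨n, rfl⟩, hδm n, hmM n⟩
  have hmlim : Tendsto (fun k => m (φ k)) atTop (𝓝 m') := (continuous_snd.tendsto _).comp hconv
  have hzlim : ∀ t : Icc (0 : ℝ) 1, Tendsto (fun k => x (φ k) t) atTop (𝓝 (z t)) := fun t =>
    ((continuous_eval_const t).tendsto z).comp
      ((continuous_fst.tendsto _).comp hconv)
  set X : ℝ → ℝ := IccExtend zero_le_one z with hX
  have hXc : Continuous X := z.continuous.Icc_extend'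
  have hXlim : ∀ t ∈ Icc (0 : ℝ) 1, Tendsto (fun k => x (φ k) t) atTop (𝓝 (X t)) := by
    intro t ht
    rw [hX, IccExtend_of_mem _ _ ht]
    exact hzlim ⟨t, ht⟩
  have hhφ : Tendsto (fun k => h (φ k)) atTop (𝓝 0) := hlim.comp hφ.tendsto_atTop
  have hylim : ∀ s ∈ Icc (0 : ℝ) 1,
      Tendsto (fun k => g s (x (φ k) (s - h (φ k)))) atTop (𝓝 (g s (X s))) := by
    intro s hs
    have h1 : Tendsto (fun k => x (φ k) s - x (φ k) (s - h (φ k))) atTop (𝓝 0) := by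
      refine squeeze_zero_norm (a := fun k => L * h (φ k)) (fun k => ?_)
        (by simpa using hhφ.const_mul L)
      have := hLip (φ k) s hs.2 (s - h (φ k)) (by linarith [hpos (φ k)])
      simpa using this
    have h2 := (hXlim s hs).sub h1
    simp only [sub_sub_cancel, sub_zero] at h2
    have h3 : Continuous (g s) := by fun_prop
    exact (h3.tendsto _).comp h2
  have hwlim : ∀ d : ℝ → ℝ, Continuous d → (∀ s ∈ Icc (0 : ℝ) 1, |d s| ≤ 1) →
      Tendsto (fun k => wInt α fun s => d s * g s (x (φ k) (s - h (φ k)))) atTop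
        (𝓝 (wInt α fun s => d s * g s (X s))) := by
    intro d hd hd1
    refine tendsto_wInt hα (B := B) (fun k => hd.mul (hyc _)) (Eventually.of_forall ?_) ?_
    · intro k s hs
      rw [abs_mul, abs_of_nonneg (hg0 _ _)]
      exact (mul_le_of_le_one_left (hg0 _ _) (hd1 s hs)).trans (hyB _ s hs)
    · exact fun s hs => (hylim s (Ioc_subset_Icc_self hs)).const_mul _
  refine ⟨m', hδ.trans_le hzm.2.1, X, hXc, fun t ht => ?_, ?_⟩
  · refine tendsto_nhds_unique (hXlim t ht) ?_
    simp only [fun k => hxeq (φ k) t ht.2]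
    refine (hmlim.mul_const t).sub (hwlim (fun s => max (t - s) 0) (by fun_prop) fun s hs => ?_)
    rw [abs_of_nonneg (le_max_right _ _)]
    exact max_le (by linarith [hs.1, ht.2]) zero_le_one
  · refine tendsto_nhds_unique hmlim ?_
    have h1 := hwlim (fun s => 1 - s) (by fun_prop) fun s hs => by
      rw [abs_of_nonneg (by linarith [hs.2])]
      linarith [hs.1]
    have h2 := hwlim (hKer η) hkc fun s hs => by
      rw [abs_of_nonneg (hKer_nonneg hη hs)]
      have := hKer_le hη hs
      nlinarith [hs.1, hs.2]
    refine (h1.add (h2.const_mul μ)).congr fun k => (hmeq (φ k)).symm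

end Limit

section Regularity

variable {α : ℝ} {y : ℝ → ℝ}

lemma wInt_ramp_eq (hα : 1 < α) (hy : Continuous y) {t : ℝ} (ht : t ∈ Icc (0 : ℝ) 1) :
    wInt α (fun s => max (t - s) 0 * y s) =
      t * (∫ s in (0 : ℝ)..t, s ^ (α - 2) * y s) - ∫ s in (0 : ℝ)..t, s ^ (α - 2) * (s * y s) := by
  have hi := fun a b => intervalIntegrable_weight_mul hα
    (by fun_prop : Continuous fun s => max (t - s) 0 * y s) a b
  unfold wInt
  rw [← intervalIntegral.integral_add_adjacent_intervals (hi 0 t) (hi t 1),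
    ← intervalIntegral.integral_const_mul,
    ← intervalIntegral.integral_sub ((intervalIntegrable_weight_mul hα hy _ _).const_mul _)
      (intervalIntegrable_weight_mul hα (by fun_prop) _ _)]
  have h2 : ∫ s in t..1, s ^ (α - 2) * (max (t - s) 0 * y s) = 0 := by
    rw [intervalIntegral.integral_congr (g := fun _ => 0), intervalIntegral.integral_zero]
    intro s hs
    rw [uIcc_of_le ht.2] at hs
    simp only [max_eq_right (by linarith [hs.1] : t - s ≤ 0), zero_mul, mul_zero]
  rw [h2, add_zero]
  refine intervalIntegral.integral_congr fun s hs => ?_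
  rw [uIcc_of_le ht.1] at hs
  simp only [max_eq_left (by linarith [hs.2] : 0 ≤ t - s)]
  ring

lemma hasDerivAt_weighted_primitive (hα : 1 < α) (hy : Continuous y) {t : ℝ} (ht : 0 < t) :
    HasDerivAt (fun u => ∫ s in (0 : ℝ)..u, s ^ (α - 2) * y s) (t ^ (α - 2) * y t) t := by
  have hc : ContinuousOn (fun s : ℝ => s ^ (α - 2) * y s) (Ioi 0) := fun s hs =>
    ((Real.continuousAt_rpow_const _ _ (Or.inl (ne_of_gt hs))).mul
      hy.continuousAt).continuousWithinAt
  exact intervalIntegral.integral_hasDerivAt_right (intervalIntegrable_weight_mul hα hy _ _)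
    (hc.stronglyMeasurableAtFilter isOpen_Ioi t ht) (hc.continuousAt (isOpen_Ioi.mem_nhds ht))

lemma hasDerivAt_wInt_ramp (hα : 1 < α) (hy : Continuous y) {t : ℝ} (ht : t ∈ Ioo (0 : ℝ) 1) :
    HasDerivAt (fun u => wInt α (fun s => max (u - s) 0 * y s))
      (∫ s in (0 : ℝ)..t, s ^ (α - 2) * y s) t := by
  have h1 := ((hasDerivAt_id t).mul (hasDerivAt_weighted_primitive hα hy ht.1)).sub
    (hasDerivAt_weighted_primitive hα (by fun_prop : Continuous fun s => s * y s) ht.1)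
  refine (h1.congr_of_eventuallyEq ?_).congr_deriv (by simp only [id]; ring)
  filter_upwards [isOpen_Ioo.mem_nhds ht] with u hu
  exact wInt_ramp_eq hα hy (Ioo_subset_Icc_self hu)

lemma integral_ramp {η s : ℝ} (hη : 0 ≤ η) (hs : 0 ≤ s) :
    ∫ t in (0 : ℝ)..η, max (t - s) 0 = max (η - s) 0 ^ 2 / 2 := by
  have hi := fun a b => (by fun_prop : Continuous fun t : ℝ => max (t - s) 0).intervalIntegrable
    (μ := volume) a b
  have hz : ∀ r, 0 ≤ r → r ≤ s → ∫ t in (0 : ℝ)..r, max (t - s) 0 = 0 := by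
    intro r hr hrs
    rw [intervalIntegral.integral_congr (g := fun _ => 0), intervalIntegral.integral_zero]
    intro t ht
    rw [uIcc_of_le hr] at ht
    simp only [max_eq_right (by linarith [ht.2] : t - s ≤ 0)]
  rcases le_total η s with h | h
  · rw [hz η hη h, max_eq_right (by linarith)]
    ring
  · rw [← intervalIntegral.integral_add_adjacent_intervals (hi 0 s) (hi s η), hz s hs le_rfl,
      max_eq_left (by linarith), intervalIntegral.integral_congr (g := fun t => t - s),
      intervalIntegral.integral_sub (by simp) (by simp), integral_id,
      intervalIntegral.integral_const]
    · simp only [smul_eq_mul]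
      ring
    · intro t ht
      rw [uIcc_of_le h] at ht
      simp only [max_eq_left (by linarith [ht.1] : 0 ≤ t - s)]

lemma integral_wInt_ramp (hα : 1 < α) (hy : Continuous y) {η : ℝ} (hη : 0 ≤ η) :
    ∫ t in (0 : ℝ)..η, wInt α (fun s => max (t - s) 0 * y s) =
      wInt α (fun s => max (η - s) 0 ^ 2 * y s) / 2 := by
  have hw := (intervalIntegrable_weight_mul hα hy 0 1).1
  have hint : Integrable (Function.uncurry fun t s : ℝ => s ^ (α - 2) * (max (t - s) 0 * y s))
      ((volume.restrict (uIoc 0 η)).prod (volume.restrict (Ioc 0 1))) := by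
    have h1 : Integrable (fun _ : ℝ => (1 : ℝ)) (volume.restrict (uIoc 0 η)) :=
      (intervalIntegrable_const (μ := volume)).def'
    have h2 := (h1.mul_prod hw).bdd_mul (f := fun p : ℝ × ℝ => max (p.1 - p.2) 0) (c := η)
      (by fun_prop : Continuous fun p : ℝ × ℝ => max (p.1 - p.2) 0).aestronglyMeasurable ?_
    · refine h2.congr (Eventually.of_forall fun p => ?_)
      simp only [Function.uncurry]
      ring
    · rw [Measure.prod_restrict]
      refine (ae_restrict_mem (measurableSet_uIoc.prod measurableSet_Ioc)).mono fun p hp => ?_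
      have hp1 := hp.1
      rw [uIoc_of_le hη] at hp1
      rw [Real.norm_eq_abs, abs_of_nonneg (le_max_right _ _)]
      exact max_le (by linarith [hp1.2, hp.2.1]) hη
  have hswap := intervalIntegral_integral_swap hint
  unfold wInt
  simp only [intervalIntegral.integral_of_le (zero_le_one (α := ℝ))]
  rw [hswap, ← integral_div]
  refine setIntegral_congr_fun measurableSet_Ioc fun s hs => ?_
  have h3 : ∀ t : ℝ, s ^ (α - 2) * (max (t - s) 0 * y s) =
      (s ^ (α - 2) * y s) * max (t - s) 0 := fun t => by ring
  simp only [h3, intervalIntegral.integral_const_mul, integral_ramp hη hs.1.le]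
  ring

end Regularity

section Nonlinearity

variable {f : ℝ → ℝ → ℝ}

/-- The extension of `f` from `[0,1] × [0,∞)` to the plane that is constant outside. -/
noncomputable def clampExtend (f : ℝ → ℝ → ℝ) (t u : ℝ) : ℝ :=
  f (projIcc (0 : ℝ) 1 zero_le_one t) (max u 0)

lemma clampExtend_eq {t : ℝ} (ht : t ∈ Icc (0 : ℝ) 1) (u : ℝ) :
    clampExtend f t u = f t (max u 0) := by
  rw [clampExtend, projIcc_of_mem _ ht]

lemma continuous_clampExtend
    (hf : ContinuousOn (fun p : ℝ × ℝ => f p.1 p.2) (Icc 0 1 ×ˢ Ici 0)) :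
    Continuous fun p : ℝ × ℝ => clampExtend f p.1 p.2 := by
  have h1 : Continuous fun p : ℝ × ℝ =>
      (((projIcc (0 : ℝ) 1 zero_le_one p.1 : Icc (0 : ℝ) 1) : ℝ), max p.2 0) :=
    (continuous_subtype_val.comp (continuous_projIcc.comp continuous_fst)).prodMk (by fun_prop)
  exact hf.comp_continuous h1 fun p => ⟨Subtype.coe_prop _, le_max_right p.2 0⟩

lemma exists_lower_slope (hfnn : ∀ t ∈ Icc (0 : ℝ) 1, ∀ u, 0 ≤ u → 0 ≤ f t u) {Λ : ℝ}
    {L : ENNReal}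
    (hL : Tendsto (fun u : ℝ => ENNReal.ofReal (sInf ((fun t => f t u / u) '' Icc (0 : ℝ) 1)))
      (𝓝[>] 0) (𝓝 L)) (hΛ : ENNReal.ofReal Λ < L) :
    ∃ δ, 0 < δ ∧ ∀ t ∈ Icc (0 : ℝ) 1, ∀ u, 0 ≤ u → u ≤ δ → Λ * u ≤ f t u := by
  obtain ⟨δ, hδ, hsub⟩ := mem_nhdsGT_iff_exists_Ioc_subset.1 (hL.eventually (lt_mem_nhds hΛ))
  refine ⟨δ, hδ, fun t ht u hu0 huδ => ?_⟩
  rcases hu0.eq_or_lt with rfl | hu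
  · rw [mul_zero]
    exact hfnn t ht 0 le_rfl
  · have h1 := (ENNReal.ofReal_lt_ofReal_iff'.1 (hsub ⟨hu, huδ⟩)).1
    have h2 : sInf ((fun t => f t u / u) '' Icc (0 : ℝ) 1) ≤ f t u / u := by
      refine csInf_le ⟨0, ?_⟩ ⟨t, ht, rfl⟩
      rintro _ ⟨r, hr, rfl⟩
      exact div_nonneg (hfnn r hr u hu0) hu0
    exact (le_div_iff₀ hu).1 (h1.le.trans h2)

lemma exists_affine_bound
    (hf : ContinuousOn (fun p : ℝ × ℝ => f p.1 p.2) (Icc 0 1 ×ˢ Ici 0)) {c : ℝ} (hc : 0 ≤ c)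
    {M : ENNReal}
    (hM : Tendsto (fun u : ℝ => ENNReal.ofReal (sSup ((fun t => f t u / u) '' Icc (0 : ℝ) 1)))
      atTop (𝓝 M)) (hMc : M < ENNReal.ofReal c) :
    ∃ C, ∀ t ∈ Icc (0 : ℝ) 1, ∀ u, 0 ≤ u → f t u ≤ c * u + C := by
  obtain ⟨U, hU⟩ := eventually_atTop.1 (hM.eventually (gt_mem_nhds hMc))
  have hsub : Icc (0 : ℝ) 1 ×ˢ Icc 0 (max U 1) ⊆ Icc (0 : ℝ) 1 ×ˢ Ici 0 :=
    prod_mono_right fun u hu => hu.1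
  obtain ⟨C, hC⟩ := (isCompact_Icc.prod isCompact_Icc).exists_bound_of_continuousOn (hf.mono hsub)
  refine ⟨max C 0, fun t ht u hu => ?_⟩
  rcases le_total u (max U 1) with h | h
  · have h1 : f t u ≤ C := (le_abs_self _).trans (hC (t, u) ⟨ht, hu, h⟩)
    linarith [le_max_left C 0, mul_nonneg hc hu]
  · have hu1 : 0 < u := by linarith [le_max_right U 1]
    have h1 := (ENNReal.ofReal_lt_ofReal_iff'.1 (hU u ((le_max_left _ _).trans h))).1
    have h2 : f t u / u ≤ sSup ((fun t => f t u / u) '' Icc (0 : ℝ) 1) := by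
      refine le_csSup (isCompact_Icc.image_of_continuousOn ?_).bddAbove ⟨t, ht, rfl⟩
      refine ContinuousOn.div_const (hf.comp (f := fun r : ℝ => (r, u)) (by fun_prop) ?_) _
      exact fun r hr => ⟨hr, hu⟩
    have h3 := (div_le_iff₀ hu1).1 (h2.trans h1.le)
    linarith [le_max_right C 0]

end Nonlinearity

end Auxiliary

open Filter Topology in
theorem stmt11 (α η lam θ : ℝ) (hα : α ∈ Set.Ioc (1 : ℝ) 2) (hη : η ∈ Set.Ioc (0 : ℝ) 1)
    (hlam0 : 0 ≤ lam) (hlam : lam < 2 / η ^ 2) (hθ : θ ∈ Set.Ioo (0 : ℝ) (1 / 2))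
    (f : ℝ → ℝ → ℝ)
    (hf : ContinuousOn (fun p : ℝ × ℝ => f p.1 p.2) (Set.Icc 0 1 ×ˢ Set.Ici 0))
    (hfnn : ∀ t ∈ Set.Icc (0 : ℝ) 1, ∀ u, 0 ≤ u → 0 ≤ f t u)
    -- `f₀ = lim_{u → 0⁺} min_{t ∈ [0,1]} f(t,u)/u` exists in `[0,∞]` and `f₀ > Λ₁`
    (hf0 : ∃ L : ENNReal,
      Tendsto (fun u : ℝ => ENNReal.ofReal (sInf ((fun t => f t u / u) '' Set.Icc (0 : ℝ) 1)))
        (nhdsWithin 0 (Set.Ioi 0)) (nhds L) ∧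
      ENNReal.ofReal ((θ ^ 4 * ∫ s in θ..(1 - θ),
        ((1 - s) * s ^ (α - 1) + lam / (2 - lam * η ^ 2) * Hf α η s))⁻¹) < L)
    -- `f^∞ = lim_{u → ∞} max_{t ∈ [0,1]} f(t,u)/u` exists in `[0,∞]` and `f^∞ < Λ₂/2`
    (hfinf : ∃ M : ENNReal,
      Tendsto (fun u : ℝ => ENNReal.ofReal (sSup ((fun t => f t u / u) '' Set.Icc (0 : ℝ) 1)))
        atTop (nhds M) ∧
      M < ENNReal.ofReal
        (((1 + lam / (2 - lam * η ^ 2)) * ∫ s in (0 : ℝ)..1, (1 - s) * s ^ (α - 1))⁻¹ / 2)) :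
    ∃ x : ℝ → ℝ, ContinuousOn x (Set.Icc 0 1) ∧
      (∀ t ∈ Set.Icc (0 : ℝ) 1, 0 ≤ x t) ∧
      (∃ t ∈ Set.Icc (0 : ℝ) 1, x t ≠ 0) ∧
      (∀ t ∈ Set.Ioo (0 : ℝ) 1, DifferentiableAt ℝ x t ∧ DifferentiableAt ℝ (deriv x) t ∧
        t ^ (2 - α) * deriv (deriv x) t + f t (x t) = 0) ∧
      x 0 = 0 ∧ x 1 = lam * ∫ t in (0 : ℝ)..η, x t := by
  have hα1 : 1 < α := hα.1
  have hkc := continuous_hKer η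
  have hD : 0 < 2 - lam * η ^ 2 := by
    have := (lt_div_iff₀ (pow_pos hη.1 2)).1 hlam
    linarith
  set μ := lam / (2 - lam * η ^ 2) with hμdef
  have hμ : 0 ≤ μ := div_nonneg hlam0 hD.le
  have hμlam : μ * (2 - lam * η ^ 2) = lam := div_mul_cancel₀ _ hD.ne'
  have hw : ∀ s : ℝ, 0 < s → s ^ (α - 1) = s ^ (α - 2) * s := fun s hs => by
    rw [show α - 1 = (α - 2) + 1 by ring, Real.rpow_add hs, Real.rpow_one]
  have hθθ : θ < 1 - θ := by linarith [hθ.2]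
  have hJeq : ∫ s in θ..(1 - θ), ((1 - s) * s ^ (α - 1) + μ * Hf α η s) =
      ∫ s in θ..(1 - θ), s ^ (α - 2) * (s * (1 - s) + μ * hKer η s) := by
    refine intervalIntegral.integral_congr fun s hs => ?_
    rw [uIcc_of_le hθθ.le] at hs
    have hs0 : 0 < s := hθ.1.trans_le hs.1
    simp only [hw s hs0, Hf_eq_weight_mul_hKer hs0]
    ring
  have hIeq : ∫ s in (0 : ℝ)..1, (1 - s) * s ^ (α - 1) = wInt α fun s => s * (1 - s) := by
    refine intervalIntegral.integral_congr_ae (Eventually.of_forall fun s hs => ?_)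
    rw [uIoc_of_le zero_le_one] at hs
    rw [hw s hs.1]
    ring
  have hJ0 : 0 < ∫ s in θ..(1 - θ), s ^ (α - 2) * (s * (1 - s) + μ * hKer η s) := by
    refine intervalIntegral.intervalIntegral_pos_of_pos_on
      (intervalIntegrable_weight_mul hα1 (by fun_prop) _ _) (fun s hs => ?_) hθθ
    have hs0 : 0 < s := hθ.1.trans hs.1
    have hs1 : s < 1 := by linarith [hs.2, hθ.1]
    have := mul_nonneg hμ (hKer_nonneg hη ⟨hs0.le, hs1.le⟩)
    have := mul_pos hs0 (sub_pos.2 hs1)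
    exact mul_pos (Real.rpow_pos_of_pos hs0 _) (by linarith)
  have hI0 : 0 < wInt α fun s => s * (1 - s) :=
    intervalIntegral.intervalIntegral_pos_of_pos_on
      (intervalIntegrable_weight_mul hα1 (by fun_prop) _ _)
      (fun s hs => mul_pos (Real.rpow_pos_of_pos hs.1 _) (mul_pos hs.1 (sub_pos.2 hs.2)))
      zero_lt_one
  obtain ⟨L, hL, hΛL⟩ := hf0
  obtain ⟨M, hM, hMc⟩ := hfinf
  rw [hJeq] at hΛL
  rw [hIeq] at hMc
  set J := ∫ s in θ..(1 - θ), s ^ (α - 2) * (s * (1 - s) + μ * hKer η s) with hJdef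
  set I := wInt α fun s => s * (1 - s) with hIdef
  obtain ⟨δ, hδ, hlow⟩ := exists_lower_slope hfnn hL hΛL
  have hθ4 : 0 < θ ^ 4 * J := mul_pos (pow_pos hθ.1 4) hJ0
  have hμI : 0 < (1 + μ) * I := mul_pos (by linarith) hI0
  have hc : 0 ≤ ((1 + μ) * I)⁻¹ / 2 := by positivity
  obtain ⟨C, hupp⟩ := exists_affine_bound hf hc hM hMc
  have hJ1 : 1 < (θ ^ 4 * J)⁻¹ * θ ^ 2 * J := by
    have hθ2 : θ ^ 2 < 1 := by nlinarith [hθ.1, hθ.2]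
    have : (θ ^ 4 * J)⁻¹ * θ ^ 2 * J = (θ ^ 2)⁻¹ := by
      have := hθ.1.ne'
      field_simp
    rw [this]
    exact (one_lt_inv₀ (pow_pos hθ.1 2)).2 hθ2
  have hI1 : ((1 + μ) * I)⁻¹ / 2 * wInt α (fun s => s * (1 - s) + μ * hKer η s) ≤ 1 / 2 := by
    have h1 : wInt α (fun s => s * (1 - s) + μ * hKer η s) ≤ (1 + μ) * I := by
      rw [hIdef, ← wInt_const_mul]
      refine wInt_mono hα1 (by fun_prop) (by fun_prop) fun s hs => ?_
      linarith [mul_le_mul_of_nonneg_left (hKer_le hη hs) hμ]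
    refine (mul_le_mul_of_nonneg_left h1 hc).trans_eq ?_
    field_simp
  have hg := continuous_clampExtend hf
  have hg0 : ∀ s u, 0 ≤ clampExtend f s u := fun s u =>
    hfnn _ (Subtype.coe_prop _) _ (le_max_right _ _)
  obtain ⟨m, hm, X, hXc, hXeq, hmeq⟩ := exists_integral_solution hα1 hη hμ hg hg0 hθ hδ
    (inv_nonneg.2 hθ4.le)
    (fun s hs u hu0 huδ => by
      rw [clampExtend_eq hs, max_eq_left hu0]
      exact hlow s hs u hu0 huδ) hJ1 hc
    (fun s hs u => by
      rw [clampExtend_eq hs]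
      exact hupp s hs _ (le_max_right _ _)) hI1
  set y : ℝ → ℝ := fun s => clampExtend f s (X s) with hydef
  have hyc : Continuous y := by fun_prop
  have hy0 : ∀ s, 0 ≤ y s := fun s => hg0 _ _
  have hb0 : 0 ≤ wInt α (fun s => hKer η s * y s) := hKer_wInt_nonneg hη hy0
  set x : ℝ → ℝ := fun t => m * t - wInt α (fun s => max (t - s) 0 * y s) with hxdef
  have hxX : ∀ t ∈ Icc (0 : ℝ) 1, x t = X t := fun t ht => (hXeq t ht).symm
  have hx0 : ∀ t ∈ Icc (0 : ℝ) 1, 0 ≤ x t := by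
    intro t ht
    have h1 := (green_wInt_bounds hα1 hyc hy0 ht).1
    have h2 : 0 ≤ t * (1 - t) * wInt α (fun s => s * (1 - s) * y s) :=
      mul_nonneg (mul_nonneg ht.1 (sub_nonneg.2 ht.2)) (wInt_nonneg fun s hs =>
        mul_nonneg (mul_nonneg hs.1 (sub_nonneg.2 hs.2)) (hy0 s))
    have h3 : 0 ≤ t * (μ * wInt α (fun s => hKer η s * y s)) :=
      mul_nonneg ht.1 (mul_nonneg hμ hb0)
    simp only [hxdef]
    rw [hmeq]
    linarith
  have hyf : ∀ t ∈ Icc (0 : ℝ) 1, y t = f t (x t) := by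
    intro t ht
    rw [hydef, hxX t ht]
    simp only
    rw [clampExtend_eq ht, max_eq_left (hxX t ht ▸ hx0 t ht)]
  have hrampc : Continuous fun t => wInt α (fun s => max (t - s) 0 * y s) :=
    continuous_wInt hα1 (P := ℝ) (c := fun t s => max (t - s) 0 * y s) (by fun_prop)
  have hxc : Continuous x := by fun_prop
  have hd1 : ∀ t ∈ Ioo (0 : ℝ) 1,
      HasDerivAt x (m - ∫ s in (0 : ℝ)..t, s ^ (α - 2) * y s) t := fun t ht =>
    (((hasDerivAt_id t).const_mul m).sub (hasDerivAt_wInt_ramp hα1 hyc ht)).congr_deriv (by simp)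
  have hd2 : ∀ t ∈ Ioo (0 : ℝ) 1, HasDerivAt (deriv x) (-(t ^ (α - 2) * y t)) t := by
    intro t ht
    have h1 := (hasDerivAt_weighted_primitive hα1 hyc ht.1).const_sub m
    refine h1.congr_of_eventuallyEq ?_
    filter_upwards [isOpen_Ioo.mem_nhds ht] with u hu
    exact (hd1 u hu).deriv
  have hode : ∀ t ∈ Ioo (0 : ℝ) 1, t ^ (2 - α) * deriv (deriv x) t + f t (x t) = 0 := by
    intro t ht
    rw [(hd2 t ht).deriv, ← hyf t (Ioo_subset_Icc_self ht)]
    have : t ^ (2 - α) * t ^ (α - 2) = 1 := by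
      rw [← Real.rpow_add ht.1, show 2 - α + (α - 2) = 0 by ring, Real.rpow_zero]
    linear_combination (-y t) * this
  refine ⟨x, hxc.continuousOn, hx0, ?_, fun t ht =>
    ⟨(hd1 t ht).differentiableAt, (hd2 t ht).differentiableAt, hode t ht⟩, ?_, ?_⟩
  · by_contra! hz
    have hyz : ∀ s ∈ Ioo (0 : ℝ) 1, y s = 0 := by
      intro t ht
      have h1 : deriv x =ᶠ[𝓝 t] fun _ => 0 := by
        filter_upwards [isOpen_Ioo.mem_nhds ht] with u hu
        have h2 : x =ᶠ[𝓝 u] fun _ => 0 := by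
          filter_upwards [isOpen_Ioo.mem_nhds hu] with v hv
          exact hz v (Ioo_subset_Icc_self hv)
        rw [h2.deriv_eq, deriv_const]
      have h3 := hode t ht
      rwa [h1.deriv_eq, deriv_const, mul_zero, zero_add,
        ← hyf t (Ioo_subset_Icc_self ht)] at h3
    have h1 := hz 1 ⟨zero_le_one, le_rfl⟩
    simp only [hxdef] at h1
    rw [wInt_congr_Ioo (d := fun s => 0 * y s) fun s hs => by simp [hyz s hs],
      wInt_const_mul] at h1
    linarith
  · simp only [hxdef]
    rw [wInt_congr (d := fun s => 0 * s), wInt_const_mul]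
    · ring
    · intro s hs
      rw [max_eq_right (by linarith [hs.1])]
      ring
  · have hint : ∫ t in (0 : ℝ)..η, x t =
        m * (η ^ 2 / 2) - wInt α (fun s => max (η - s) 0 ^ 2 * y s) / 2 := by
      rw [← integral_wInt_ramp hα1 hyc hη.1.le]
      simp only [hxdef]
      rw [intervalIntegral.integral_sub ((continuous_const_mul m).intervalIntegrable
          _ _) (hrampc.intervalIntegrable _ _), intervalIntegral.integral_const_mul, integral_id]
      ring
    have hb : wInt α (fun s => hKer η s * y s) =
        η ^ 2 * wInt α (fun s => (1 - s) * y s) -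
          wInt α (fun s => max (η - s) 0 ^ 2 * y s) := by
      rw [← wInt_const_mul, ← wInt_sub hα1 (by fun_prop) (by fun_prop)]
      exact wInt_congr fun s _ => by rw [hKer]; ring
    have hx1 : x 1 = m - wInt α (fun s => (1 - s) * y s) := by
      simp only [hxdef, mul_one]
      congr 1
      exact wInt_congr fun s hs => by rw [max_eq_left (sub_nonneg.2 hs.2)]
    rw [hx1, hint]
    have hm' : m = wInt α (fun s => (1 - s) * y s) + μ * wInt α (fun s => hKer η s * y s) := hmeq
    generalize wInt α (fun s => max (η - s) 0 ^ 2 * y s) = r at *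
    generalize wInt α (fun s => (1 - s) * y s) = a at *
    generalize wInt α (fun s => hKer η s * y s) = b at *
    have hr : r = η ^ 2 * a - b := by linarith
    rw [hm', hr]
    linear_combination (b / 2) * hμlam
end
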